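/- Let d ∈ ℕ, 1 < p < ∞, 0 < q ≤ ∞ and k ∈ ℕ with k ≤ d/p. There is a constant C > 0 such that for every f ∈ L_{p,q}(ℝ^d) and every t > 0, (∫_0^{t^d} (u^{1/p} (f^#)^*(u))^q du/u)^{1/q} ≤ C · ω_k(f,t)_{p,q} (with the integral replaced by a supremum when q = ∞). -/

import Mathlib

open MeasureTheory ENNReal Set Filter

noncomputable section

abbrev Euc (d : ℕ) := EuclideanSpace ℝ (Fin d)

/-- Non-increasing rearrangement of an `ℝ≥0∞`-valued function w.r.t. a measure. -/
def rearr {α : Type*} [MeasurableSpace α] (μ : Measure α) (g : α → ℝ≥0∞) (t : ℝ) : ℝ≥0∞ :=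
  sInf {l : ℝ≥0∞ | μ {x | l < g x} ≤ ENNReal.ofReal t}

/-- Non-increasing rearrangement of a real-valued function. -/
def rearrR {α : Type*} [MeasurableSpace α] (μ : Measure α) (f : α → ℝ) (t : ℝ) : ℝ≥0∞ :=
  rearr μ (fun x => ENNReal.ofReal |f x|) t

/-- The maximal function `f^{**}(t) = t⁻¹ ∫_0^t f^*`. -/
def rearrStar {α : Type*} [MeasurableSpace α] (μ : Measure α) (f : α → ℝ) (t : ℝ) : ℝ≥0∞ :=
  (ENNReal.ofReal t)⁻¹ * ∫⁻ s in Set.Ioo (0:ℝ) t, rearrR μ f s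

/-- `(∫_I g(t)^q dt/t)^{1/q}`, with the usual sup modification when `q = ∞`. -/
def qnorm (q : ℝ≥0∞) (I : Set ℝ) (g : ℝ → ℝ≥0∞) : ℝ≥0∞ :=
  if q = ∞ then ⨆ t ∈ I, g t
  else (∫⁻ t in I, g t ^ q.toReal / ENNReal.ofReal t) ^ (1 / q.toReal)

/-- `∫_I g(t)^q dt/t` (no outer power), with the sup modification when `q = ∞`. -/
def qint (q : ℝ≥0∞) (I : Set ℝ) (g : ℝ → ℝ≥0∞) : ℝ≥0∞ :=
  if q = ∞ then ⨆ t ∈ I, g t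
  else ∫⁻ t in I, g t ^ q.toReal / ENNReal.ofReal t

/-- Lorentz quasinorm `(∫_I (t^{1/p} f^*(t))^q dt/t)^{1/q}`. -/
def lorentz {α : Type*} [MeasurableSpace α] (μ : Measure α) (f : α → ℝ)
    (p : ℝ) (q : ℝ≥0∞) (I : Set ℝ) : ℝ≥0∞ :=
  qnorm q I (fun t => ENNReal.ofReal (t ^ (1 / p)) * rearrR μ f t)

/-- The cube with lower-left corner `a` and side length `l`. -/
def cubeSet {d : ℕ} (a : Fin d → ℝ) (l : ℝ) : Set (Euc d) :=
  {x | ∀ i, a i ≤ x i ∧ x i ≤ a i + l}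

/-- Cubes in `ℝ^d` with sides parallel to the coordinate axes. -/
def IsCube {d : ℕ} (Q : Set (Euc d)) : Prop := ∃ a l, 0 < l ∧ Q = cubeSet a l

/-- The sharp maximal function `f^{#}` on `ℝ^d`. -/
def sharp {d : ℕ} (f : Euc d → ℝ) (x : Euc d) : ℝ≥0∞ :=
  ⨆ Q ∈ {Q : Set (Euc d) | IsCube Q ∧ x ∈ Q},
    ENNReal.ofReal (⨍ y in Q, |f y - ⨍ z in Q, f z|)

/-- The local sharp maximal function `f^{#}_{Q_0;μ}`. -/
def sharpLocal {d : ℕ} (μ : Measure (Euc d)) (Q0 : Set (Euc d)) (f : Euc d → ℝ)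
    (x : Euc d) : ℝ≥0∞ :=
  ⨆ Q ∈ {Q : Set (Euc d) | IsCube Q ∧ x ∈ Q ∧ Q ⊆ Q0},
    ENNReal.ofReal (⨍ y in Q, |f y - ⨍ z in Q, f z ∂μ| ∂μ)

def diffOp {d : ℕ} (h : Euc d) (f : Euc d → ℝ) : Euc d → ℝ := fun x => f (x + h) - f x

/-- The iterated difference `Δ_h^k f`. -/
def iterDiff {d : ℕ} (k : ℕ) (h : Euc d) (f : Euc d → ℝ) : Euc d → ℝ := (diffOp h)^[k] f

/-- The modulus of smoothness `ω_k(f,t)_{p,q}` on `ℝ^d`. -/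
def modulus {d : ℕ} (k : ℕ) (f : Euc d → ℝ) (p : ℝ) (q : ℝ≥0∞) (t : ℝ) : ℝ≥0∞ :=
  ⨆ h ∈ {h : Euc d | ‖h‖ ≤ t}, lorentz volume (iterDiff k h f) p q (Set.Ioi 0)


section

theorem rearr_meas_le {α : Type*} [MeasurableSpace α] (μ : Measure α) (g : α → ℝ≥0∞) (t : ℝ) :
    μ {x | rearr μ g t < g x} ≤ ENNReal.ofReal t := by
  set S := {l : ℝ≥0∞ | μ {x | l < g x} ≤ ENNReal.ofReal t} with hS
  have hne : S.Nonempty := ⟨⊤, by simp [hS]⟩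
  obtain ⟨u, hu, hlim, hmem⟩ := exists_seq_tendsto_sInf hne (OrderBot.bddBelow S)
  have h1 : {x | rearr μ g t < g x} = ⋃ n, {x | u n < g x} := by
    ext x
    simp only [mem_ofPred_eq, mem_iUnion]
    constructor
    · intro hx
      exact (hlim.eventually (gt_mem_nhds hx)).exists
    · rintro ⟨n, hn⟩
      exact lt_of_le_of_lt (sInf_le (hmem n)) hn
  rw [h1, Monotone.measure_iUnion]
  · exact iSup_le fun n => hmem n
  · intro m n hmn x hx
    exact lt_of_le_of_lt (hu hmn) hx

theorem rearr_anti {α : Type*} [MeasurableSpace α] (μ : Measure α) (g : α → ℝ≥0∞) {s t : ℝ}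
    (h : s ≤ t) : rearr μ g t ≤ rearr μ g s :=
  sInf_le ((rearr_meas_le μ g s).trans (ENNReal.ofReal_le_ofReal h))

theorem rearrR_anti {α : Type*} [MeasurableSpace α] (μ : Measure α) (g : α → ℝ) {s t : ℝ}
    (h : s ≤ t) : rearrR μ g t ≤ rearrR μ g s := rearr_anti μ _ h

def PP {d : ℕ} (ρ : ℝ≥0∞) (g : Euc d → ℝ) (v : ℝ) : ℝ≥0∞ :=
  ⨆ i : ℕ, (ρ ^ i)⁻¹ * rearrR volume g (v / 2 ^ i)

theorem PP_anti {d : ℕ} (ρ : ℝ≥0∞) (g : Euc d → ℝ) {s t : ℝ} (h : s ≤ t) :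
    PP ρ g t ≤ PP ρ g s := by
  unfold PP
  gcongr with i
  exact rearrR_anti _ _ (by gcongr)

def Crho (ρ : ℝ≥0∞) : ℝ≥0∞ := 1 + ∑' i : ℕ, ρ ^ (i + 1) * (2 ^ i)⁻¹

theorem Crho_ne_top {ρ : ℝ≥0∞} (h2 : ρ < 2) : Crho ρ ≠ ∞ := by
  unfold Crho
  have : ∀ i : ℕ, ρ ^ (i + 1) * (2 ^ i)⁻¹ = ρ * (ρ / 2) ^ i := by
    intro i
    rw [div_eq_mul_inv, mul_pow, ENNReal.inv_pow, pow_succ]; ring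
  simp only [this]
  rw [ENNReal.tsum_mul_left, ENNReal.tsum_geometric]
  refine ENNReal.add_ne_top.2 ⟨by simp, ENNReal.mul_ne_top h2.ne_top ?_⟩
  rw [ENNReal.inv_ne_top]
  have : ρ / 2 < 1 := by
    rw [ENNReal.div_lt_iff (by simp) (by simp)]; simpa using h2
  exact (tsub_pos_of_lt this).ne'

theorem setL_le_aux {d : ℕ} {ρ : ℝ≥0∞} (h1 : 1 < ρ) (g : Euc d → ℝ) (hg : Measurable g)
    (E : Set (Euc d)) (v : ℝ≥0∞) (hE : volume E ≤ v) (B : ℝ≥0∞) (hB : B ≠ 0)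
    (H : ∀ i : ℕ, volume {x | ρ ^ i * B < ‖g x‖ₑ} ≤ v * (2 ^ i)⁻¹) :
    ∫⁻ x in E, ‖g x‖ₑ ≤ Crho ρ * v * B := by
  have hpt : ∀ x, ‖g x‖ₑ ≤ B + ∑' i : ℕ,
      ({x | ρ ^ i * B < ‖g x‖ₑ}).indicator (fun _ => ρ ^ (i + 1) * B) x := by
    intro x
    by_cases hx : ‖g x‖ₑ ≤ B
    · exact hx.trans le_self_add
    · push Not at hx
      have hex : ∃ n : ℕ, ‖g x‖ₑ ≤ ρ ^ n * B := by
        have ht : Tendsto (fun n : ℕ => ρ ^ n * B) atTop (nhds (∞ * B)) :=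
          ENNReal.Tendsto.mul_const (ENNReal.tendsto_pow_atTop_nhds_top_iff.2 h1) (Or.inl (by simp))
        rw [ENNReal.top_mul hB] at ht
        have := ht.eventually (lt_mem_nhds (enorm_lt_top (x := g x)))
        obtain ⟨n, hn⟩ := this.exists
        exact ⟨n, hn.le⟩
      classical
      set n := Nat.find hex with hn
      have hspec : ‖g x‖ₑ ≤ ρ ^ n * B := Nat.find_spec hex
      have hn0 : n ≠ 0 := by
        intro h0
        rw [h0] at hspec
        simp at hspec
        exact absurd hspec (not_le.2 hx)
      obtain ⟨m, hm⟩ := Nat.exists_eq_succ_of_ne_zero hn0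
      have hlt : ρ ^ m * B < ‖g x‖ₑ := by
        have := Nat.find_min hex (m := m) (by omega)
        exact not_le.1 this
      refine le_trans ?_ (le_add_left (ENNReal.le_tsum m))
      rw [Set.indicator_of_mem (by exact hlt)]
      rw [hm] at hspec
      exact hspec
  have hm : ∀ i : ℕ, MeasurableSet {x | ρ ^ i * B < ‖g x‖ₑ} := fun i =>
    measurableSet_lt measurable_const hg.enorm
  calc ∫⁻ x in E, ‖g x‖ₑ ≤ ∫⁻ x in E, (B + ∑' i : ℕ,
      ({x | ρ ^ i * B < ‖g x‖ₑ}).indicator (fun _ => ρ ^ (i + 1) * B) x) := lintegral_mono hpt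
    _ = B * volume E + ∑' i : ℕ, ∫⁻ x in E,
        ({x | ρ ^ i * B < ‖g x‖ₑ}).indicator (fun _ => ρ ^ (i + 1) * B) x := by
      rw [lintegral_add_left measurable_const, lintegral_tsum]
      · simp
      · intro i
        exact (measurable_const.indicator (hm i)).aemeasurable
    _ ≤ B * v + ∑' i : ℕ, (ρ ^ (i + 1) * (2 ^ i)⁻¹) * (v * B) := by
      gcongr with i
      rw [lintegral_indicator_const (hm i)]
      calc ρ ^ (i + 1) * B * (volume.restrict E) {x | ρ ^ i * B < ‖g x‖ₑ}
          ≤ ρ ^ (i + 1) * B * (v * (2 ^ i)⁻¹) := by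
            gcongr
            exact (Measure.restrict_apply_le _ _).trans (H i)
        _ = _ := by ring
    _ = Crho ρ * v * B := by
      rw [ENNReal.tsum_mul_right, Crho]; ring

theorem setL_le {d : ℕ} {ρ : ℝ≥0∞} (h1 : 1 < ρ) (h2 : ρ < 2) (g : Euc d → ℝ) (hg : Measurable g)
    (E : Set (Euc d)) (v : ℝ) (hv : 0 < v) (hE : volume E ≤ ENNReal.ofReal v) :
    ∫⁻ x in E, ‖g x‖ₑ ≤ Crho ρ * ENNReal.ofReal v * PP ρ g v := by
  have hC : Crho ρ * ENNReal.ofReal v ≠ ∞ := ENNReal.mul_ne_top (Crho_ne_top h2) (by simp)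
  have hC0 : Crho ρ * ENNReal.ofReal v ≠ 0 := by
    have : Crho ρ ≠ 0 := by unfold Crho; simp
    simp [this, hv]
  rw [mul_comm, ← ENNReal.div_le_iff hC0 hC]
  refine le_of_forall_gt_imp_ge_of_dense fun B hB => ?_
  rw [ENNReal.div_le_iff hC0 hC, mul_comm]
  refine setL_le_aux h1 g hg E _ hE B (ne_bot_of_gt hB) fun i => ?_
  have h3 : rearrR volume g (v / 2 ^ i) ≤ ρ ^ i * B := by
    have h4 : (ρ ^ i)⁻¹ * rearrR volume g (v / 2 ^ i) ≤ B :=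
      (le_iSup (fun i : ℕ => (ρ ^ i)⁻¹ * rearrR volume g (v / 2 ^ i)) i).trans hB.le
    have h5 : ρ ^ i ≠ 0 := pow_ne_zero _ (ne_bot_of_gt h1)
    have h6 : ρ ^ i ≠ ∞ := ENNReal.pow_ne_top h2.ne_top
    calc rearrR volume g (v / 2 ^ i) = ρ ^ i * ((ρ ^ i)⁻¹ * rearrR volume g (v / 2 ^ i)) := by
          rw [← mul_assoc, ENNReal.mul_inv_cancel h5 h6, one_mul]
      _ ≤ _ := by gcongr
  have h7 := rearr_meas_le volume (fun x => ENNReal.ofReal |g x|) (v / 2 ^ i)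
  calc volume {x | ρ ^ i * B < ‖g x‖ₑ} ≤ volume {x | rearrR volume g (v / 2 ^ i) < ‖g x‖ₑ} := by
        apply measure_mono
        intro x hx
        exact lt_of_le_of_lt h3 hx
    _ ≤ ENNReal.ofReal (v / 2 ^ i) := by
        simpa [rearrR, Real.enorm_eq_ofReal_abs] using h7
    _ = _ := by
        rw [div_eq_mul_inv, ENNReal.ofReal_mul hv.le, ENNReal.ofReal_inv_of_pos (by positivity),
          ENNReal.ofReal_pow (by norm_num)]
        simp

end

section

/-- dilation invariance of `dv/v`. -/
theorem lintegral_dil (Φ : ℝ → ℝ≥0∞) (c : ℝ) (hc : 0 < c) :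
    ∫⁻ v in Ioi (0:ℝ), Φ (v / c) / ENNReal.ofReal v
      = ∫⁻ v in Ioi (0:ℝ), Φ v / ENNReal.ofReal v := by
  have hemb : MeasurableEmbedding (fun x : ℝ => c * x) :=
    (Homeomorph.mulLeft₀ c hc.ne').measurableEmbedding
  rw [← lintegral_indicator measurableSet_Ioi, ← lintegral_indicator measurableSet_Ioi]
  conv_lhs => rw [← Real.smul_map_volume_mul_left hc.ne']
  rw [lintegral_smul_measure, hemb.lintegral_map, abs_of_pos hc, smul_eq_mul,
    ← lintegral_const_mul' _ _ ENNReal.ofReal_ne_top]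
  congr 1
  ext x
  by_cases hx : 0 < x
  · rw [Set.indicator_of_mem (by exact mul_pos hc hx), Set.indicator_of_mem (by exact hx),
      mul_div_cancel_left₀ _ hc.ne', ENNReal.ofReal_mul hc.le, mul_comm, ENNReal.div_eq_inv_mul,
      ENNReal.div_eq_inv_mul, ENNReal.mul_inv (by simp [hc]) (by simp)]
    have : (ENNReal.ofReal c)⁻¹ * ENNReal.ofReal c = 1 :=
      ENNReal.inv_mul_cancel (by simp [hc]) (by simp)
    calc _ = ((ENNReal.ofReal c)⁻¹ * ENNReal.ofReal c) * ((ENNReal.ofReal x)⁻¹ * Φ x) := by ring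
      _ = _ := by rw [this, one_mul]
  · have hx' : ¬ (0 < c * x) := by
      intro h; exact hx (pos_of_mul_pos_right h hc.le)
    rw [Set.indicator_of_notMem (by exact hx'), Set.indicator_of_notMem (by exact hx), mul_zero]

theorem qnorm_dil (q : ℝ≥0∞) (hq : 0 < q) (p : ℝ) (H : ℝ → ℝ≥0∞) (c : ℝ)
    (hc : 0 < c) :
    qnorm q (Ioi 0) (fun v => ENNReal.ofReal (v ^ (1 / p)) * H (v / c)) ≤
      ENNReal.ofReal (c ^ (1 / p)) *
        qnorm q (Ioi 0) (fun v => ENNReal.ofReal (v ^ (1 / p)) * H v) := by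
  have key : ∀ v : ℝ, 0 < v → ENNReal.ofReal (v ^ (1 / p)) * H (v / c) =
      ENNReal.ofReal (c ^ (1 / p)) * (ENNReal.ofReal ((v / c) ^ (1 / p)) * H (v / c)) := by
    intro v hv
    rw [← mul_assoc, ← ENNReal.ofReal_mul (by positivity), ← Real.mul_rpow hc.le (by positivity),
      mul_div_cancel₀ _ hc.ne']
  unfold qnorm
  split_ifs with h
  · refine iSup₂_le fun v hv => ?_
    beta_reduce
    rw [key v hv]
    gcongr
    exact le_iSup₂ (f := fun v (_ : v ∈ Ioi (0:ℝ)) => ENNReal.ofReal (v ^ (1 / p)) * H v) (v / c)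
      (div_pos hv hc)
  · have hq' : 0 < q.toReal := ENNReal.toReal_pos hq.ne' h
    have h1 : ∫⁻ t in Ioi (0:ℝ), (ENNReal.ofReal (t ^ (1 / p)) * H (t / c)) ^ q.toReal
          / ENNReal.ofReal t
        = (ENNReal.ofReal (c ^ (1 / p))) ^ q.toReal *
          ∫⁻ t in Ioi (0:ℝ), (ENNReal.ofReal (t ^ (1 / p)) * H t) ^ q.toReal
          / ENNReal.ofReal t := by
      rw [← lintegral_dil (fun t => (ENNReal.ofReal (t ^ (1 / p)) * H t) ^ q.toReal) c hc,
        ← lintegral_const_mul' _ _ (ENNReal.rpow_ne_top_of_nonneg hq'.le ENNReal.ofReal_ne_top)]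
      refine setLIntegral_congr_fun measurableSet_Ioi fun v hv => ?_
      rw [key v hv, ENNReal.mul_rpow_of_nonneg _ _ hq'.le, mul_div_assoc]
    rw [h1, ENNReal.mul_rpow_of_nonneg _ _ (by positivity), ← ENNReal.rpow_mul,
      mul_one_div_cancel hq'.ne', ENNReal.rpow_one]

theorem qnorm_mono (q : ℝ≥0∞) {I J : Set ℝ} (hIJ : I ⊆ J) (hI : MeasurableSet I)
    {g h : ℝ → ℝ≥0∞} (hgh : ∀ v ∈ I, g v ≤ h v) : qnorm q I g ≤ qnorm q J h := by
  unfold qnorm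
  split_ifs with hq
  · exact iSup₂_le fun v hv => (hgh v hv).trans (le_iSup₂ (f := fun v (_ : v ∈ J) => h v) v (hIJ hv))
  · gcongr ?_ ^ (_ : ℝ)
    refine (setLIntegral_mono' hI ?_).trans (lintegral_mono_set hIJ)
    intro v hv
    gcongr
    exact hgh v hv

theorem qnorm_const_mul (q : ℝ≥0∞) (hq : 0 < q) (I : Set ℝ) (g : ℝ → ℝ≥0∞) (c : ℝ≥0∞)
    (hc : c ≠ ∞) : qnorm q I (fun v => c * g v) = c * qnorm q I g := by
  unfold qnorm
  split_ifs with h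
  · simp only [ENNReal.mul_iSup]
  · have hq' : 0 < q.toReal := ENNReal.toReal_pos hq.ne' h
    have : ∀ t, (c * g t) ^ q.toReal / ENNReal.ofReal t = c ^ q.toReal *
        (g t ^ q.toReal / ENNReal.ofReal t) := by
      intro t
      rw [ENNReal.mul_rpow_of_nonneg _ _ hq'.le, mul_div_assoc]
    simp only [this]
    rw [lintegral_const_mul' _ _ (ENNReal.rpow_ne_top_of_nonneg hq'.le hc),
      ENNReal.mul_rpow_of_nonneg _ _ (by positivity), ← ENNReal.rpow_mul,
      mul_one_div_cancel hq'.ne', ENNReal.rpow_one]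

/-- quasi triangle inequality. -/
theorem qnorm_add (q : ℝ≥0∞) (hq : 0 < q) : ∃ C : ℝ≥0∞, C ≠ ∞ ∧ ∀ (I : Set ℝ) (_ : MeasurableSet I)
    (g h : ℝ → ℝ≥0∞), Measurable h →
    qnorm q I (fun v => g v + h v) ≤ C * (qnorm q I g + qnorm q I h) := by
  by_cases hqt : q = ∞
  · refine ⟨1, by simp, fun I hI g h hh => ?_⟩
    simp only [qnorm, hqt, if_true, one_mul]
    refine iSup₂_le fun v hv => add_le_add ?_ ?_
    · exact (le_iSup₂ (f := fun v (_ : v ∈ I) => g v) v hv)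
    · exact (le_iSup₂ (f := fun v (_ : v ∈ I) => h v) v hv)
  · have hq' : 0 < q.toReal := ENNReal.toReal_pos hq.ne' hqt
    have base : ∀ (r : ℝ), 0 < r → ∀ x y : ℝ≥0∞, (x + y) ^ r ≤ 2 ^ r * (x ^ r + y ^ r) := by
      intro r hr x y
      rcases le_total x y with h | h
      · calc (x + y) ^ r ≤ (2 * y) ^ r := by gcongr; rw [two_mul]; gcongr
          _ = 2 ^ r * y ^ r := ENNReal.mul_rpow_of_nonneg _ _ hr.le
          _ ≤ _ := by gcongr; exact le_add_self
      · calc (x + y) ^ r ≤ (2 * x) ^ r := by gcongr; rw [two_mul]; gcongr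
          _ = 2 ^ r * x ^ r := ENNReal.mul_rpow_of_nonneg _ _ hr.le
          _ ≤ _ := by gcongr; exact le_self_add
    refine ⟨(2 ^ q.toReal) ^ (1 / q.toReal) * 2 ^ (1 / q.toReal), ?_, fun I hI g h hh => ?_⟩
    · refine ENNReal.mul_ne_top (ENNReal.rpow_ne_top_of_nonneg (by positivity)
        (ENNReal.rpow_ne_top_of_nonneg (by positivity) (by simp)))
        (ENNReal.rpow_ne_top_of_nonneg (by positivity) (by simp))
    · simp only [qnorm, hqt, if_false]
      calc (∫⁻ t in I, (g t + h t) ^ q.toReal / ENNReal.ofReal t) ^ (1 / q.toReal)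
          ≤ (∫⁻ t in I, 2 ^ q.toReal * (g t ^ q.toReal / ENNReal.ofReal t
              + h t ^ q.toReal / ENNReal.ofReal t)) ^ (1 / q.toReal) := by
            gcongr with t
            rw [← ENNReal.add_div, ← mul_div_assoc]
            gcongr
            exact base _ hq' _ _
        _ = (2 ^ q.toReal * ((∫⁻ t in I, g t ^ q.toReal / ENNReal.ofReal t)
              + ∫⁻ t in I, h t ^ q.toReal / ENNReal.ofReal t)) ^ (1 / q.toReal) := by
            rw [lintegral_const_mul' _ _ (ENNReal.rpow_ne_top_of_nonneg (by positivity) (by simp)),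
              lintegral_add_right _ (show Measurable (fun t =>
                h t ^ q.toReal / ENNReal.ofReal t) from (hh.pow_const _).div (by fun_prop))]
        _ ≤ _ := by
            rw [ENNReal.mul_rpow_of_nonneg _ _ (by positivity), mul_assoc]
            gcongr
            exact base _ (by positivity) _ _

/-- weak type bound -/
theorem rearrR_weak {d : ℕ} (p : ℝ) (hp : 1 < p) (q : ℝ≥0∞) (hq : 0 < q) :
    ∃ C : ℝ≥0∞, C ≠ ∞ ∧ ∀ (g : Euc d → ℝ) (v : ℝ), 0 < v →
      ENNReal.ofReal (v ^ (1 / p)) * rearrR volume g v ≤ C * lorentz volume g p q (Ioi 0) := by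
  by_cases hqt : q = ∞
  · refine ⟨1, by simp, fun g v hv => ?_⟩
    simp only [lorentz, qnorm, hqt, if_true, one_mul]
    exact (le_iSup₂ (f := fun v (_ : v ∈ Ioi (0:ℝ)) =>
      ENNReal.ofReal (v ^ (1 / p)) * rearrR volume g v) v hv)
  · have hq' : 0 < q.toReal := ENNReal.toReal_pos hq.ne' hqt
    refine ⟨ENNReal.ofReal (2 ^ (1 / p)) * 2 ^ (1 / q.toReal), ENNReal.mul_ne_top (by simp)
      (ENNReal.rpow_ne_top_of_nonneg (by positivity) (by simp)), fun g v hv => ?_⟩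
    simp only [lorentz, qnorm, hqt, if_false]
    set X := ENNReal.ofReal ((v / 2) ^ (1 / p)) * rearrR volume g v with hX
    have h1 : X ^ q.toReal / 2 ≤ ∫⁻ t in Ioi (0:ℝ),
        (ENNReal.ofReal (t ^ (1 / p)) * rearrR volume g t) ^ q.toReal / ENNReal.ofReal t := by
      calc X ^ q.toReal / 2 = ∫⁻ t in Ioo (v / 2) v, X ^ q.toReal / ENNReal.ofReal v := by
            rw [setLIntegral_const, Real.volume_Ioo, show v - v / 2 = v * (1 / 2) by ring,
              ENNReal.ofReal_mul hv.le, ← mul_assoc, ENNReal.div_mul_cancel (by simp [hv]) (by simp)]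
            simp [div_eq_mul_inv]
        _ ≤ ∫⁻ t in Ioo (v / 2) v,
          (ENNReal.ofReal (t ^ (1 / p)) * rearrR volume g t) ^ q.toReal / ENNReal.ofReal t := by
            refine setLIntegral_mono' measurableSet_Ioo fun t ht => ?_
            have ht0 : 0 < t := by have := ht.1; linarith
            rw [hX]
            gcongr
            · exact ht.1.le
            · exact rearrR_anti _ _ ht.2.le
            · exact ht.2.le
        _ ≤ _ := lintegral_mono_set fun t ht => by
            have := ht.1; simp only [mem_Ioi]; linarith
    have h2 : X ≤ 2 ^ (1 / q.toReal) * (∫⁻ t in Ioi (0:ℝ),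
        (ENNReal.ofReal (t ^ (1 / p)) * rearrR volume g t) ^ q.toReal / ENNReal.ofReal t)
          ^ (1 / q.toReal) := by
      rw [← ENNReal.mul_rpow_of_nonneg _ _ (by positivity), one_div q.toReal, ENNReal.le_rpow_inv_iff hq',
        mul_comm]
      rwa [ENNReal.div_le_iff (by simp) (by simp)] at h1
    calc ENNReal.ofReal (v ^ (1 / p)) * rearrR volume g v = ENNReal.ofReal (2 ^ (1 / p)) * X := by
          rw [hX, ← mul_assoc, ← ENNReal.ofReal_mul (by positivity),
            ← Real.mul_rpow (by norm_num) (by positivity)]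
          congr 4; ring
      _ ≤ _ := by rw [mul_assoc]; gcongr

theorem iSup_rpow_le (a : ℕ → ℝ≥0∞) (r : ℝ) (hr : 0 < r) : (⨆ i, a i) ^ r ≤ ∑' i, (a i) ^ r := by
  rw [← ENNReal.le_rpow_inv_iff hr]
  refine iSup_le fun i => ?_
  rw [ENNReal.le_rpow_inv_iff hr]
  exact ENNReal.le_tsum i

theorem exists_rho (p : ℝ) (hp : 1 < p) : ∃ ρ : ℝ≥0∞, 1 < ρ ∧ ρ < 2 ∧
    ENNReal.ofReal (2 ^ (1 / p)) < ρ := by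
  have h1 : (2:ℝ) ^ (1 / p) < 2 := by
    conv_rhs => rw [← Real.rpow_one 2]
    apply Real.rpow_lt_rpow_of_exponent_lt (by norm_num)
    rw [div_lt_one (by linarith)]; exact hp
  have h3 : (1:ℝ) < (2:ℝ) ^ (1 / p) := Real.one_lt_rpow (by norm_num) (by positivity)
  have h2 : ENNReal.ofReal (2 ^ (1 / p)) < 2 := by
    rw [← ENNReal.ofReal_ofNat 2]
    exact (ENNReal.ofReal_lt_ofReal_iff (by norm_num)).2 h1
  obtain ⟨ρ, ha, hb⟩ := exists_between h2
  refine ⟨ρ, lt_trans ?_ ha, hb, ha⟩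
  rw [← ENNReal.ofReal_one]
  exact (ENNReal.ofReal_lt_ofReal_iff (by linarith)).2 h3

theorem PP_weak {d : ℕ} (p : ℝ) (hp : 1 < p) (q : ℝ≥0∞) (hq : 0 < q) (ρ : ℝ≥0∞) 
    (hρ : ENNReal.ofReal (2 ^ (1 / p)) < ρ) :
    ∃ C : ℝ≥0∞, C ≠ ∞ ∧ ∀ (g : Euc d → ℝ) (v : ℝ), 0 < v →
      ENNReal.ofReal (v ^ (1 / p)) * PP ρ g v ≤ C * lorentz volume g p q (Ioi 0) := by
  obtain ⟨C, hC, H⟩ := rearrR_weak (d := d) p hp q hq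
  refine ⟨C, hC, fun g v hv => ?_⟩
  unfold PP
  rw [ENNReal.mul_iSup]
  refine iSup_le fun i => le_trans ?_ (H g (v / 2 ^ i) (by positivity))
  have : ENNReal.ofReal (v ^ (1 / p)) = ENNReal.ofReal (2 ^ (1 / p)) ^ i *
      ENNReal.ofReal ((v / 2 ^ i) ^ (1 / p)) := by
    rw [← ENNReal.ofReal_pow (by positivity), ← Real.rpow_natCast, ← Real.rpow_mul (by norm_num),
      mul_comm (1 / p), Real.rpow_mul (by norm_num), ← ENNReal.ofReal_mul (by positivity),
      Real.rpow_natCast, ← Real.mul_rpow (by positivity) (by positivity),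
      mul_div_cancel₀ _ (by positivity)]
  rw [this]
  calc _ = (ENNReal.ofReal (2 ^ (1 / p)) ^ i * (ρ ^ i)⁻¹) * (ENNReal.ofReal ((v / 2 ^ i) ^ (1 / p))
      * rearrR volume g (v / 2 ^ i)) := by ring
    _ ≤ 1 * (ENNReal.ofReal ((v / 2 ^ i) ^ (1 / p)) * rearrR volume g (v / 2 ^ i)) := by
      gcongr
      rw [← div_eq_mul_inv]
      apply ENNReal.div_le_of_le_mul
      rw [one_mul]
      gcongr
    _ = _ := one_mul _

theorem rearr_meas_aux {β : Type*} [MeasurableSpace β] {α : Type*} [MeasurableSpace α]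
    (μ : Measure α) [SFinite μ]
    (G : β → α → ℝ) (hG : Measurable (Function.uncurry G)) :
    Measurable (fun z : β × ℝ => rearrR μ (G z.1) z.2) := by
  apply measurable_of_Iio
  intro a
  have : (fun z : β × ℝ => rearrR μ (G z.1) z.2) ⁻¹' (Iio a) =
      ⋃ r : {r : ℚ // ENNReal.ofReal r < a}, {z : β × ℝ |
        μ {x | ENNReal.ofReal (r : ℚ) < ENNReal.ofReal |G z.1 x|} ≤ ENNReal.ofReal z.2} := by
    ext z
    simp only [mem_preimage, mem_Iio, mem_iUnion, mem_ofPred_eq, rearrR, rearr, sInf_lt_iff]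
    constructor
    · rintro ⟨l, hl, hla⟩
      obtain ⟨r, hr0, hr1, hr2⟩ := ENNReal.lt_iff_exists_rat_btwn.1 hla
      refine ⟨⟨r, hr2⟩, le_trans (measure_mono ?_) hl⟩
      intro x hx
      exact lt_trans hr1 hx
    · rintro ⟨⟨r, hr⟩, hz⟩
      exact ⟨_, hz, hr⟩
  rw [this]
  refine MeasurableSet.iUnion fun r => ?_
  apply measurableSet_le
  · have hs : MeasurableSet {w : β × α | ENNReal.ofReal ((r : ℚ) : ℝ)
        < ENNReal.ofReal |G w.1 w.2|} := by
      apply measurableSet_lt measurable_const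
      have : Measurable (fun w : β × α => G w.1 w.2) := hG
      exact (this.abs).ennreal_ofReal
    exact (measurable_measure_prodMk_left (ν := μ) hs).comp measurable_fst
  · exact measurable_snd.ennreal_ofReal

theorem PP_meas {d : ℕ} (ρ : ℝ≥0∞) {β : Type*} [MeasurableSpace β] (G : β → Euc d → ℝ)
    (hG : Measurable (Function.uncurry G)) :
    Measurable (fun z : β × ℝ => PP ρ (G z.1) z.2) := by
  unfold PP
  refine Measurable.iSup fun i => Measurable.const_mul ?_ _
  exact (rearr_meas_aux volume G hG).comp
    (measurable_fst.prodMk (measurable_snd.div_const _))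

theorem PP_strong {d : ℕ} (p : ℝ) (hp : 1 < p) (q : ℝ≥0∞) (hq : 0 < q) (hqt : q ≠ ∞) (ρ : ℝ≥0∞)
    (h1 : 1 < ρ) (h2 : ρ < 2) (hρ : ENNReal.ofReal (2 ^ (1 / p)) < ρ) :
    ∃ C : ℝ≥0∞, C ≠ ∞ ∧ ∀ (g : Euc d → ℝ), Measurable g →
      ∫⁻ v in Ioi (0:ℝ), (ENNReal.ofReal (v ^ (1 / p)) * PP ρ g v) ^ q.toReal / ENNReal.ofReal v
        ≤ C * lorentz volume g p q (Ioi 0) ^ q.toReal := by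
  have hq' : 0 < q.toReal := ENNReal.toReal_pos hq.ne' hqt
  have hρ0 : ρ ≠ 0 := ne_bot_of_gt h1
  set κ : ℝ≥0∞ := (ENNReal.ofReal (2 ^ (1 / p)) / ρ) ^ q.toReal with hκ
  have hκ1 : κ < 1 := by
    apply ENNReal.rpow_lt_one _ hq'
    rwa [ENNReal.div_lt_iff (Or.inl hρ0) (Or.inl h2.ne_top), one_mul]
  refine ⟨∑' i : ℕ, κ ^ i, ?_, fun g hg => ?_⟩
  · rw [ENNReal.tsum_geometric, ENNReal.inv_ne_top]
    exact (tsub_pos_of_lt hκ1).ne'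
  have hgm : Measurable (rearrR (volume : Measure (Euc d)) g) := by
    have := rearr_meas_aux (β := Unit) (volume : Measure (Euc d)) (fun _ => g)
      (hg.comp measurable_snd)
    exact this.comp (measurable_const (a := ()).prodMk measurable_id)
  have hL : lorentz volume g p q (Ioi 0) ^ q.toReal =
      ∫⁻ v in Ioi (0:ℝ), (ENNReal.ofReal (v ^ (1 / p)) * rearrR volume g v) ^ q.toReal
        / ENNReal.ofReal v := by
    simp only [lorentz, qnorm, hqt, if_false]
    rw [← ENNReal.rpow_mul, one_div_mul_cancel hq'.ne', ENNReal.rpow_one]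
  set W := ∫⁻ v in Ioi (0:ℝ), (ENNReal.ofReal (v ^ (1 / p)) * rearrR volume g v) ^ q.toReal
        / ENNReal.ofReal v with hW
  calc ∫⁻ v in Ioi (0:ℝ), (ENNReal.ofReal (v ^ (1 / p)) * PP ρ g v) ^ q.toReal / ENNReal.ofReal v
      ≤ ∫⁻ v in Ioi (0:ℝ), ∑' i : ℕ, κ ^ i *
        ((ENNReal.ofReal ((v / 2 ^ i) ^ (1 / p)) * rearrR volume g (v / 2 ^ i)) ^ q.toReal
          / ENNReal.ofReal v) := by
        refine setLIntegral_mono' measurableSet_Ioi fun v hv => ?_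
        have hv : 0 < v := hv
        simp only [← mul_div_assoc]
        simp only [div_eq_mul_inv _ (ENNReal.ofReal v)]
        rw [ENNReal.tsum_mul_right]
        gcongr
        unfold PP
        rw [ENNReal.mul_iSup]
        refine (iSup_rpow_le _ _ hq').trans ?_
        gcongr with i
        rw [hκ, ← ENNReal.rpow_natCast (_ ^ q.toReal), ← ENNReal.rpow_mul, mul_comm q.toReal, ENNReal.rpow_mul,
          ENNReal.rpow_natCast, ← ENNReal.mul_rpow_of_nonneg _ _ hq'.le]
        gcongr ?_ ^ (_ : ℝ)
        apply le_of_eq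
        have : ENNReal.ofReal (v ^ (1 / p)) = ENNReal.ofReal (2 ^ (1 / p)) ^ i *
            ENNReal.ofReal ((v / 2 ^ i) ^ (1 / p)) := by
          rw [← ENNReal.ofReal_pow (by positivity), ← Real.rpow_natCast,
            ← Real.rpow_mul (by norm_num),
            mul_comm (1 / p), Real.rpow_mul (by norm_num), ← ENNReal.ofReal_mul (by positivity),
            Real.rpow_natCast, ← Real.mul_rpow (by positivity) (by positivity),
            mul_div_cancel₀ _ (by positivity)]
        rw [this, div_eq_mul_inv _ ρ, mul_pow, ENNReal.inv_pow]
        ring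
    _ = ∑' i : ℕ, κ ^ i * W := by
        rw [lintegral_tsum]
        · congr 1
          ext i
          rw [lintegral_const_mul' _ _ (ENNReal.pow_ne_top hκ1.ne_top), hW,
            lintegral_dil (fun v => (ENNReal.ofReal (v ^ (1 / p)) * rearrR volume g v) ^ q.toReal)
              (2 ^ i) (by positivity)]
        · intro i
          have : Measurable fun v : ℝ => rearrR volume g (v / 2 ^ i) :=
            hgm.comp (measurable_id.div_const _)
          refine Measurable.aemeasurable ?_
          fun_prop
    _ = _ := by rw [ENNReal.tsum_mul_right, hL]

end

section

def sgc (k j : ℕ) : ℝ := (-1 : ℝ) ^ (k - j) * (k.choose j : ℝ)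

theorem iterDiff_sum {d : ℕ} (k : ℕ) (h : Euc d) (f : Euc d → ℝ) (x : Euc d) :
    iterDiff k h f x = ∑ j ∈ Finset.range (k + 1), sgc k j * f (x + (j : ℝ) • h) := by
  have h1 : diffOp (d := d) h = fwdDiff h := by
    ext f x; rfl
  rw [iterDiff, h1, fwdDiff_iter_eq_sum_shift]
  refine Finset.sum_congr rfl fun j _ => ?_
  rw [zsmul_eq_mul, Nat.cast_smul_eq_nsmul, sgc]
  push_cast
  rfl

theorem iterDiff_meas {d : ℕ} (k : ℕ) (f : Euc d → ℝ) (hf : Measurable f) :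
    Measurable (Function.uncurry (fun (h : Euc d) (x : Euc d) => iterDiff k h f x)) := by
  simp only [Function.uncurry_def, iterDiff_sum]
  refine Finset.measurable_sum _ fun j _ => Measurable.const_mul ?_ _
  have : Measurable fun p : Euc d × Euc d => p.2 + (j : ℝ) • p.1 := by fun_prop
  exact hf.comp this

theorem iterDiff_meas' {d : ℕ} (k : ℕ) (h : Euc d) (f : Euc d → ℝ) (hf : Measurable f) :
    Measurable (iterDiff k h f) :=
  (iterDiff_meas k f hf).comp (measurable_const.prodMk measurable_id)

theorem iterDiff_ident {d : ℕ} (k : ℕ) (f : Euc d → ℝ) (c a x : Euc d) :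
    ∑ j ∈ Finset.range (k + 1), sgc k j * iterDiff k (((j : ℝ) + 1) • a) f (x + (j : ℝ) • c) =
    ∑ i ∈ Finset.range (k + 1), sgc k i * iterDiff k (c + (i : ℝ) • a) f (x + (i : ℝ) • a) := by
  simp only [iterDiff_sum, Finset.mul_sum]
  rw [Finset.sum_comm]
  refine Finset.sum_congr rfl fun i _ => Finset.sum_congr rfl fun j _ => ?_
  have : x + (j : ℝ) • c + (i : ℝ) • (((j : ℝ) + 1) • a) =
      x + (i : ℝ) • a + (j : ℝ) • (c + (i : ℝ) • a) := by module
  rw [this]; ring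

theorem abs_sgc_le (k j : ℕ) : ‖sgc k j‖ₑ ≤ 2 ^ k := by
  have : |sgc k j| ≤ 2 ^ k := by
    rw [sgc, abs_mul, abs_pow, abs_neg, abs_one, one_pow, one_mul, Nat.abs_cast]
    exact_mod_cast Nat.choose_le_two_pow k j
  rw [Real.enorm_eq_ofReal_abs]
  refine (ENNReal.ofReal_le_ofReal this).trans ?_
  rw [ENNReal.ofReal_pow (by norm_num)]; simp

theorem iterDiff_bound {d : ℕ} (k : ℕ) (f : Euc d → ℝ) (c a x : Euc d) :
    ‖iterDiff k c f x‖ₑ ≤ 2 ^ k * ∑ j ∈ Finset.range (k + 1),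
      (‖iterDiff k (((j : ℝ) + 1) • a) f (x + (j : ℝ) • c)‖ₑ +
       ‖iterDiff k (c + ((j : ℝ) + 1) • a) f (x + ((j : ℝ) + 1) • a)‖ₑ) := by
  have h := iterDiff_ident k f c a x
  rw [Finset.sum_range_succ' (fun i : ℕ =>
    sgc k i * iterDiff k (c + (i : ℝ) • a) f (x + (i : ℝ) • a))] at h
  simp only [Nat.cast_zero, zero_smul, add_zero] at h
  have h0 : ‖iterDiff k c f x‖ₑ = ‖sgc k 0 * iterDiff k c f x‖ₑ := by
    rw [enorm_mul]
    simp [sgc, Real.enorm_eq_ofReal_abs]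
  have h1 : sgc k 0 * iterDiff k c f x = ∑ j ∈ Finset.range (k + 1),
      sgc k j * iterDiff k (((j : ℝ) + 1) • a) f (x + (j : ℝ) • c) -
      ∑ j ∈ Finset.range k, sgc k (j + 1) * iterDiff k (c + ((j : ℝ) + 1) • a) f
        (x + ((j : ℝ) + 1) • a) := by
    rw [h]; push_cast; ring
  rw [h0, h1]
  refine (enorm_sub_le).trans ?_
  rw [Finset.sum_add_distrib, mul_add, Finset.mul_sum, Finset.mul_sum]
  gcongr
  · refine (enorm_sum_le _ _).trans (Finset.sum_le_sum fun j _ => ?_)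
    rw [enorm_mul]
    gcongr
    exact abs_sgc_le _ _
  · refine (enorm_sum_le _ _).trans ?_
    refine le_trans (Finset.sum_le_sum fun j _ => ?_) (Finset.sum_le_sum_of_subset
      (Finset.range_mono (Nat.le_succ k)))
    rw [enorm_mul]
    gcongr
    exact abs_sgc_le _ _

theorem shift_bound {d : ℕ} (g : Euc d → ℝ) (v X : ℝ≥0∞)
    (H : ∀ E : Set (Euc d), MeasurableSet E → volume E ≤ v → ∫⁻ x in E, ‖g x‖ₑ ≤ X) (y : Euc d) :
    ∀ E : Set (Euc d), MeasurableSet E → volume E ≤ v → ∫⁻ x in E, ‖g (x + y)‖ₑ ≤ X := by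
  intro E hE hv
  have h1 : ∫⁻ x in E, ‖g (x + y)‖ₑ = ∫⁻ x in (fun x => x - y) ⁻¹' E, ‖g x‖ₑ := by
    rw [← lintegral_indicator hE, ← lintegral_indicator (measurable_sub_const y hE),
      ← lintegral_sub_right_eq_self _ y]
    congr 1
    ext x
    by_cases hx : x - y ∈ E
    · rw [Set.indicator_of_mem hx, Set.indicator_of_mem (by exact hx), sub_add_cancel]
    · rw [Set.indicator_of_notMem hx, Set.indicator_of_notMem (by exact hx)]
  rw [h1]
  refine H _ (measurable_sub_const y hE) ?_
  have : volume ((fun x => x - y) ⁻¹' E) = volume E := by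
    simp only [sub_eq_add_neg]
    exact measure_preimage_add_right volume (-y) E
  rw [this]; exact hv

theorem lintegral_affine_le {d : ℕ} (Ψ : Euc d → ℝ≥0∞) (c : Euc d) (n : ℝ) (hn : 1 ≤ n) :
    ∫⁻ a, Ψ (c + n • a) ≤ ∫⁻ a, Ψ a := by
  have hn0 : n ≠ 0 := by linarith
  have hemb : MeasurableEmbedding (fun x : Euc d => n • x) :=
    (Homeomorph.smulOfNeZero n hn0).measurableEmbedding
  have h1 : ∫⁻ a, Ψ (c + n • a) = ∫⁻ b, Ψ (c + b) ∂(Measure.map (fun x : Euc d => n • x) volume) :=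
    (hemb.lintegral_map (fun b => Ψ (c + b))).symm
  rw [h1, Measure.map_addHaar_smul _ hn0, lintegral_smul_measure,
    lintegral_add_left_eq_self]
  calc _ ≤ (1 : ℝ≥0∞) • ∫⁻ a, Ψ a := by
        simp only [smul_eq_mul]
        gcongr
        rw [ENNReal.ofReal_le_one, abs_of_nonneg (by positivity)]
        exact inv_le_one_of_one_le₀ (one_le_pow₀ hn)
    _ = _ := one_smul _ _

theorem sum_rpow_le {ι : Type*} (s : Finset ι) (x : ι → ℝ≥0∞) (r : ℝ) (hr : 0 < r) :
    (∑ i ∈ s, x i) ^ r ≤ (s.card : ℝ≥0∞) ^ r * ∑ i ∈ s, (x i) ^ r := by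
  have h1 : ∀ i ∈ s, x i ≤ (∑ i ∈ s, (x i) ^ r) ^ (r⁻¹) := by
    intro i hi
    rw [ENNReal.le_rpow_inv_iff hr]
    exact Finset.single_le_sum (f := fun i => x i ^ r) (fun _ _ => bot_le) hi
  calc (∑ i ∈ s, x i) ^ r ≤ ((s.card : ℝ≥0∞) * (∑ i ∈ s, (x i) ^ r) ^ (r⁻¹)) ^ r := by
        gcongr
        refine (Finset.sum_le_sum h1).trans ?_
        simp
    _ = _ := by
        rw [ENNReal.mul_rpow_of_nonneg _ _ hr.le, ← ENNReal.rpow_mul, inv_mul_cancel₀ hr.ne',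
          ENNReal.rpow_one]

theorem lint_ball_le {d : ℕ} (Φ : Euc d → ℝ≥0∞) (c : Euc d) (n r t : ℝ) (hn : 1 ≤ n)
    (h : ‖c‖ + n * r ≤ t) :
    ∫⁻ a in Metric.closedBall (0 : Euc d) r, Φ (c + n • a) ≤
      ∫⁻ a in Metric.closedBall (0 : Euc d) t, Φ a := by
  rw [← lintegral_indicator measurableSet_closedBall,
    ← lintegral_indicator measurableSet_closedBall]
  refine le_trans (lintegral_mono fun a => ?_) (lintegral_affine_le _ c n hn)
  by_cases ha : a ∈ Metric.closedBall (0 : Euc d) r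
  · rw [Set.indicator_of_mem ha, Set.indicator_of_mem]
    rw [mem_closedBall_zero_iff] at ha ⊢
    calc ‖c + n • a‖ ≤ ‖c‖ + ‖n • a‖ := norm_add_le _ _
      _ ≤ ‖c‖ + n * r := by
        rw [norm_smul, Real.norm_of_nonneg (by linarith)]
        gcongr
      _ ≤ t := h
  · rw [Set.indicator_of_notMem ha]; exact bot_le

end

section

theorem modulus_le {d : ℕ} (k : ℕ) (f : Euc d → ℝ) (p : ℝ) (q : ℝ≥0∞) (t : ℝ) (h : Euc d)
    (hh : ‖h‖ ≤ t) : lorentz volume (iterDiff k h f) p q (Ioi 0) ≤ modulus k f p q t :=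
  le_iSup₂ (f := fun (h : Euc d) (_ : h ∈ {h : Euc d | ‖h‖ ≤ t}) =>
    lorentz volume (iterDiff k h f) p q (Ioi 0)) h hh

def Envelope {d : ℕ} (k : ℕ) (f : Euc d → ℝ) (L : ℝ) (F : ℝ → ℝ≥0∞) : Prop :=
  ∀ c : Euc d, ‖c‖ ≤ L → ∀ v : ℝ, 0 < v → ∀ E : Set (Euc d), MeasurableSet E →
    volume E ≤ ENNReal.ofReal v → ∫⁻ x in E, ‖iterDiff k c f x‖ₑ ≤ ENNReal.ofReal v * F v

theorem envelope_top (d : ℕ) (p : ℝ) (hp : 1 < p) (k : ℕ) :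
    ∃ C : ℝ≥0∞, C ≠ ∞ ∧ ∀ f : Euc d → ℝ, Measurable f → ∀ t : ℝ, 0 < t → ∃ F : ℝ → ℝ≥0∞,
      (∀ s u, s ≤ u → F u ≤ F s) ∧ Envelope k f (t / 2) F ∧
      qnorm ∞ (Ioi 0) (fun v => ENNReal.ofReal (v ^ (1 / p)) * F v) ≤ C * modulus k f p ∞ t := by
  obtain ⟨ρ, h1, h2, h3⟩ := exists_rho p hp
  obtain ⟨C, hC, H⟩ := PP_weak (d := d) p hp ∞ (by simp) ρ h3
  refine ⟨Crho ρ * C, ENNReal.mul_ne_top (Crho_ne_top h2) hC, fun f hf t ht => ?_⟩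
  refine ⟨fun v => Crho ρ * ⨆ h ∈ {h : Euc d | ‖h‖ ≤ t}, PP ρ (iterDiff k h f) v, ?_, ?_, ?_⟩
  · intro s u hsu
    dsimp only
    gcongr with h hh
    exact PP_anti _ _ hsu
  · intro c hc v hv E hE hEv
    refine (setL_le h1 h2 _ (iterDiff_meas' k c f hf) E v hv hEv).trans ?_
    rw [mul_comm (Crho ρ), mul_assoc]
    dsimp only
    gcongr
    exact le_iSup₂ (f := fun (h : Euc d) (_ : h ∈ {h : Euc d | ‖h‖ ≤ t}) =>
      PP ρ (iterDiff k h f) v) c (by simp only [mem_ofPred_eq]; linarith)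
  · unfold qnorm
    rw [if_pos rfl]
    refine iSup₂_le fun v hv => ?_
    dsimp only
    rw [mul_left_comm, mul_assoc]
    refine mul_le_mul' le_rfl ?_
    simp only [ENNReal.mul_iSup]
    refine iSup₂_le fun h hh => (H _ v hv).trans ?_
    gcongr
    exact modulus_le k f p ∞ t h hh

theorem swap_meas {d : ℕ} (P : Euc d → ℝ → ℝ≥0∞) (p s : ℝ)
    (h : Measurable fun z : Euc d × ℝ => P z.1 z.2) :
    Measurable (Function.uncurry fun (v : ℝ) (h : Euc d) =>
        ((ENNReal.ofReal (v ^ (1 / p)) * P h v) ^ s / ENNReal.ofReal v)) := by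
  have h4 : Measurable fun z : ℝ × Euc d => P z.2 z.1 := h.comp measurable_swap
  have h5 : Measurable fun z : ℝ × Euc d => ENNReal.ofReal (z.1 ^ (1 / p)) :=
    (measurable_fst.pow_const _).ennreal_ofReal
  exact ((h5.mul h4).pow_const s).div measurable_fst.ennreal_ofReal

set_option maxHeartbeats 1000000 in
theorem envelope_fin (d : ℕ) (p : ℝ) (hp : 1 < p) (q : ℝ≥0∞) (hq : 0 < q) (hqt : q ≠ ∞) (k : ℕ) :
    ∃ C : ℝ≥0∞, C ≠ ∞ ∧ ∀ f : Euc d → ℝ, Measurable f → ∀ t : ℝ, 0 < t → ∃ F : ℝ → ℝ≥0∞,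
      (∀ s u, s ≤ u → F u ≤ F s) ∧ Envelope k f (t / 2) F ∧
      qnorm q (Ioi 0) (fun v => ENNReal.ofReal (v ^ (1 / p)) * F v) ≤ C * modulus k f p q t := by
  obtain ⟨ρ, h1, h2, h3⟩ := exists_rho p hp
  obtain ⟨C, hC, H⟩ := PP_strong (d := d) p hp q hq hqt ρ h1 h2 h3
  have hq' : 0 < q.toReal := ENNReal.toReal_pos hq.ne' hqt
  set s := q.toReal with hs
  set C1 : ℝ≥0∞ := Crho ρ * 2 ^ k with hC1
  have hC1t : C1 ≠ ∞ := ENNReal.mul_ne_top (Crho_ne_top h2) (by simp)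
  have hC10 : C1 ≠ 0 := by
    have : Crho ρ ≠ 0 := by unfold Crho; simp
    simp [hC1, this]
  set N : ℝ≥0∞ := ((k + 1 : ℕ) : ℝ≥0∞) with hN
  set C2 : ℝ≥0∞ := N ^ s * (2 ^ s * (N * 2)) with hC2
  have hC2t : C2 ≠ ∞ := by
    simp only [hC2, hN]
    refine ENNReal.mul_ne_top (ENNReal.rpow_ne_top_of_nonneg hq'.le (by simp))
      (ENNReal.mul_ne_top (ENNReal.rpow_ne_top_of_nonneg hq'.le (by simp))
      (ENNReal.mul_ne_top (by simp) (by simp)))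
  set R : ℝ := 2 * ((k : ℝ) + 1) with hR
  have hRpos : 0 < R := by positivity
  refine ⟨C1 * (C2 * (ENNReal.ofReal (R ^ d) * C)) ^ (1 / s), ?_, fun f hf t ht => ?_⟩
  · refine ENNReal.mul_ne_top hC1t (ENNReal.rpow_ne_top_of_nonneg (by positivity) ?_)
    exact ENNReal.mul_ne_top hC2t (ENNReal.mul_ne_top (by simp) hC)
  set r : ℝ := t / R with hr
  have hr0 : 0 < r := by positivity
  set Vr : ℝ≥0∞ := volume (Metric.closedBall (0 : Euc d) r) with hVr
  have hVr0 : Vr ≠ 0 := (Metric.measure_closedBall_pos volume _ hr0).ne'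
  have hVrt : Vr ≠ ∞ := measure_closedBall_lt_top.ne
  have hVt : volume (Metric.closedBall (0 : Euc d) t) = ENNReal.ofReal (R ^ d) * Vr := by
    have : t = R * r := by rw [hr]; field_simp
    rw [this, Measure.addHaar_closedBall_mul _ _ hRpos.le hr0.le]
    simp [hVr]
  set G : ℝ → ℝ≥0∞ := fun v => ∫⁻ h in Metric.closedBall (0 : Euc d) t,
    (PP ρ (iterDiff k h f) v) ^ s with hG
  refine ⟨fun v => C1 * (C2 * (Vr⁻¹ * G v)) ^ (1 / s), ?_, ?_, ?_⟩
  · intro a b hab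
    simp only [hG]
    gcongr with h
    exact PP_anti _ _ hab
  · intro c hc v hv E hE hEv
    -- the pointwise estimate for every `a`
    have step : ∀ a : Euc d, ∫⁻ x in E, ‖iterDiff k c f x‖ₑ ≤
        ENNReal.ofReal v * C1 * ∑ j ∈ Finset.range (k + 1),
          (PP ρ (iterDiff k ((0 : Euc d) + ((j : ℝ) + 1) • a) f) v +
            PP ρ (iterDiff k (c + ((j : ℝ) + 1) • a) f) v) := by
      intro a
      have hS : ∀ h y : Euc d, ∫⁻ x in E, ‖iterDiff k h f (x + y)‖ₑ ≤
          Crho ρ * ENNReal.ofReal v * PP ρ (iterDiff k h f) v := fun h y =>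
        shift_bound _ (ENNReal.ofReal v) _ (fun E' _ hE' =>
          setL_le h1 h2 _ (iterDiff_meas' k h f hf) E' v hv hE') y E hE hEv
      have hm : ∀ h y : Euc d, Measurable fun x => ‖iterDiff k h f (x + y)‖ₑ := fun h y =>
        ((iterDiff_meas' k h f hf).comp (measurable_add_const y)).enorm
      calc ∫⁻ x in E, ‖iterDiff k c f x‖ₑ ≤ ∫⁻ x in E, 2 ^ k * ∑ j ∈ Finset.range (k + 1),
            (‖iterDiff k (((j : ℝ) + 1) • a) f (x + (j : ℝ) • c)‖ₑ +
             ‖iterDiff k (c + ((j : ℝ) + 1) • a) f (x + ((j : ℝ) + 1) • a)‖ₑ) :=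
              lintegral_mono fun x => iterDiff_bound k f c a x
        _ = 2 ^ k * ∑ j ∈ Finset.range (k + 1),
            ((∫⁻ x in E, ‖iterDiff k (((j : ℝ) + 1) • a) f (x + (j : ℝ) • c)‖ₑ) +
             (∫⁻ x in E, ‖iterDiff k (c + ((j : ℝ) + 1) • a) f (x + ((j : ℝ) + 1) • a)‖ₑ)) := by
            rw [lintegral_const_mul' _ _ (by simp), lintegral_finsetSum]
            · congr 1
              refine Finset.sum_congr rfl fun j _ => ?_
              rw [lintegral_add_left (hm _ _)]
            · intro j _
              exact (hm _ _).add (hm _ _)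
        _ ≤ 2 ^ k * ∑ j ∈ Finset.range (k + 1),
            (Crho ρ * ENNReal.ofReal v * PP ρ (iterDiff k (((j : ℝ) + 1) • a) f) v +
             Crho ρ * ENNReal.ofReal v * PP ρ (iterDiff k (c + ((j : ℝ) + 1) • a) f) v) := by
            gcongr
            · exact hS _ _
            · exact hS _ _
        _ = _ := by
            simp only [← mul_add, ← Finset.mul_sum, zero_add, hC1]
            ring
    set D : ℝ≥0∞ := ENNReal.ofReal v * C1 with hD
    have hD0 : D ≠ 0 := mul_ne_zero (by simp [hv]) hC10
    have hDt : D ≠ ∞ := ENNReal.mul_ne_top (by simp) hC1t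
    set X := (∫⁻ x in E, ‖iterDiff k c f x‖ₑ) / D with hX
    have hXs : ∀ a : Euc d, X ^ s ≤ N ^ s * (2 ^ s * ∑ j ∈ Finset.range (k + 1),
        (PP ρ (iterDiff k ((0 : Euc d) + ((j : ℝ) + 1) • a) f) v ^ s +
            PP ρ (iterDiff k (c + ((j : ℝ) + 1) • a) f) v ^ s)) := by
      intro a
      have := step a
      rw [mul_comm, ← ENNReal.div_le_iff hD0 hDt] at this
      calc X ^ s ≤ _ := by
            gcongr
        _ ≤ _ := sum_rpow_le _ _ _ hq'
        _ ≤ _ := by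
            simp only [Finset.card_range, hN]
            gcongr
            rw [Finset.mul_sum]
            refine Finset.sum_le_sum fun j _ => ?_
            have := sum_rpow_le (Finset.univ : Finset (Fin 2))
              ![PP ρ (iterDiff k ((0 : Euc d) + ((j : ℝ) + 1) • a) f) v,
                PP ρ (iterDiff k (c + ((j : ℝ) + 1) • a) f) v] s hq'
            simpa [Fin.sum_univ_two] using this
    have hPm : ∀ (b : Euc d) (n : ℝ), Measurable fun a : Euc d =>
        PP ρ (iterDiff k (b + n • a) f) v ^ s := by
      intro b n
      have h1 : Measurable fun z : Euc d × ℝ => PP ρ (iterDiff k z.1 f) z.2 :=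
        PP_meas ρ (fun h => iterDiff k h f) (iterDiff_meas k f hf)
      have h2 : Measurable fun a : Euc d => (b + n • a, v) := by fun_prop
      exact (h1.comp h2).pow_const s
    have hint : Vr * X ^ s ≤ C2 * G v := by
      calc Vr * X ^ s = ∫⁻ a in Metric.closedBall (0 : Euc d) r, X ^ s := by
            rw [setLIntegral_const, mul_comm]
        _ ≤ ∫⁻ a in Metric.closedBall (0 : Euc d) r, N ^ s * (2 ^ s *
            ∑ j ∈ Finset.range (k + 1),
            (PP ρ (iterDiff k ((0 : Euc d) + ((j : ℝ) + 1) • a) f) v ^ s +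
            PP ρ (iterDiff k (c + ((j : ℝ) + 1) • a) f) v ^ s)) := lintegral_mono fun a => hXs a
        _ = N ^ s * (2 ^ s * ∑ j ∈ Finset.range (k + 1),
            ((∫⁻ a in Metric.closedBall (0 : Euc d) r,
              PP ρ (iterDiff k ((0 : Euc d) + ((j : ℝ) + 1) • a) f) v ^ s) +
             (∫⁻ a in Metric.closedBall (0 : Euc d) r,
              PP ρ (iterDiff k (c + ((j : ℝ) + 1) • a) f) v ^ s))) := by
            rw [lintegral_const_mul' _ _ (ENNReal.rpow_ne_top_of_nonneg hq'.le (by simp [hN])),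
              lintegral_const_mul' _ _ (ENNReal.rpow_ne_top_of_nonneg hq'.le (by simp)),
              lintegral_finsetSum]
            · congr 2
              refine Finset.sum_congr rfl fun j _ => ?_
              rw [lintegral_add_left (hPm _ _)]
            · intro j _
              exact (hPm _ _).add (hPm _ _)
        _ ≤ N ^ s * (2 ^ s * ∑ j ∈ Finset.range (k + 1), (G v + G v)) := by
            have hkr : ((k : ℝ) + 1) * r = t / 2 := by
              rw [hr, hR]; field_simp
            gcongr with j hj j hj
            all_goals
              have hj' : (j : ℝ) ≤ k := by
                exact_mod_cast Nat.lt_succ_iff.1 (Finset.mem_range.1 hj)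
              have hj2 : ((j : ℝ) + 1) * r ≤ t / 2 := by
                rw [← hkr]; gcongr
            · exact lint_ball_le (fun h => PP ρ (iterDiff k h f) v ^ s) 0 ((j : ℝ) + 1) r t
                (by linarith [Nat.cast_nonneg (α := ℝ) j]) (by rw [norm_zero]; linarith)
            · exact lint_ball_le (fun h => PP ρ (iterDiff k h f) v ^ s) c ((j : ℝ) + 1) r t
                (by linarith [Nat.cast_nonneg (α := ℝ) j]) (by linarith)
        _ = C2 * G v := by
            rw [Finset.sum_const, Finset.card_range, nsmul_eq_mul, hC2, ← two_mul]
            ring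
    have hXle : X ≤ (C2 * (Vr⁻¹ * G v)) ^ (1 / s) := by
      rw [one_div, ENNReal.le_rpow_inv_iff hq']
      calc X ^ s = Vr⁻¹ * (Vr * X ^ s) := by
            rw [← mul_assoc, ENNReal.inv_mul_cancel hVr0 hVrt, one_mul]
        _ ≤ Vr⁻¹ * (C2 * G v) := by gcongr
        _ = _ := by ring
    rw [hX, ENNReal.div_le_iff hD0 hDt] at hXle
    refine hXle.trans (le_of_eq ?_)
    rw [hD]; ring
  · have hcm : (fun v : ℝ => ENNReal.ofReal (v ^ (1 / p)) *
        (fun v => C1 * (C2 * (Vr⁻¹ * G v)) ^ (1 / s)) v) = fun v : ℝ => C1 *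
        (ENNReal.ofReal (v ^ (1 / p)) * (C2 * (Vr⁻¹ * G v)) ^ (1 / s)) := by
      ext v; dsimp only; rw [mul_left_comm]
    rw [hcm]
    rw [qnorm_const_mul _ hq _ _ _ hC1t, mul_assoc C1]
    refine mul_le_mul' le_rfl ?_
    simp only [qnorm, hqt, if_false, ← hs]
    have hmod : modulus k f p q t = (modulus k f p q t ^ s) ^ (1 / s) := by
      rw [← ENNReal.rpow_mul, mul_one_div_cancel hq'.ne', ENNReal.rpow_one]
    rw [hmod, ← ENNReal.mul_rpow_of_nonneg _ _ (by positivity)]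
    gcongr ?_ ^ (_ : ℝ)
    have hPm : Measurable fun z : Euc d × ℝ => PP ρ (iterDiff k z.1 f) z.2 :=
      PP_meas ρ (fun h => iterDiff k h f) (iterDiff_meas k f hf)
    have hSw := swap_meas (fun h v => PP ρ (iterDiff k h f) v) p s hPm
    clear_value C2 Vr C1
    calc ∫⁻ v in Ioi (0:ℝ), (ENNReal.ofReal (v ^ (1 / p)) * (C2 * (Vr⁻¹ * G v)) ^ (1 / s)) ^ s
          / ENNReal.ofReal v
        = ∫⁻ v in Ioi (0:ℝ), (C2 * Vr⁻¹) * ∫⁻ h in Metric.closedBall (0 : Euc d) t,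
          ((ENNReal.ofReal (v ^ (1 / p)) * PP ρ (iterDiff k h f) v) ^ s / ENNReal.ofReal v) := by
          refine setLIntegral_congr_fun measurableSet_Ioi fun v hv => ?_
          rw [ENNReal.mul_rpow_of_nonneg _ _ hq'.le, ← ENNReal.rpow_mul,
            one_div_mul_cancel hq'.ne', ENNReal.rpow_one]
          have hvp : 0 < v := hv
          have : ∀ h : Euc d, (ENNReal.ofReal (v ^ (1 / p)) * PP ρ (iterDiff k h f) v) ^ s
              / ENNReal.ofReal v = (ENNReal.ofReal (v ^ (1 / p)) ^ s / ENNReal.ofReal v) *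
                PP ρ (iterDiff k h f) v ^ s := by
            intro h
            rw [ENNReal.mul_rpow_of_nonneg _ _ hq'.le]
            simp only [div_eq_mul_inv]
            ring
          simp only [this]
          rw [lintegral_const_mul']
          · simp only [hG, div_eq_mul_inv]; ring
          · exact ENNReal.div_ne_top (ENNReal.rpow_ne_top_of_nonneg hq'.le (by simp))
              (by simp [hvp])
      _ = (C2 * Vr⁻¹) * ∫⁻ h in Metric.closedBall (0 : Euc d) t, ∫⁻ v in Ioi (0:ℝ),
          ((ENNReal.ofReal (v ^ (1 / p)) * PP ρ (iterDiff k h f) v) ^ s / ENNReal.ofReal v) := by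
          rw [lintegral_const_mul' _ _ (ENNReal.mul_ne_top hC2t (ENNReal.inv_ne_top.2 hVr0)),
            lintegral_lintegral_swap]
          exact hSw.aemeasurable
      _ ≤ (C2 * Vr⁻¹) * ∫⁻ h in Metric.closedBall (0 : Euc d) t,
            (C * modulus k f p q t ^ s) := by
          refine mul_le_mul' le_rfl ?_
          refine setLIntegral_mono' measurableSet_closedBall fun h hh => ?_
          refine (H _ (iterDiff_meas' k h f hf)).trans ?_
          gcongr
          exact modulus_le k f p q t h (by simpa using hh)
      _ = (Vr⁻¹ * Vr) * (C2 * (ENNReal.ofReal (R ^ d) * C) * modulus k f p q t ^ s) := by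
          rw [setLIntegral_const, hVt]
          ring
      _ = _ := by rw [ENNReal.inv_mul_cancel hVr0 hVrt, one_mul]

theorem envelope_exists (d : ℕ) (p : ℝ) (hp : 1 < p) (q : ℝ≥0∞) (hq : 0 < q) (k : ℕ) :
    ∃ C : ℝ≥0∞, C ≠ ∞ ∧ ∀ f : Euc d → ℝ, Measurable f → ∀ t : ℝ, 0 < t → ∃ F : ℝ → ℝ≥0∞,
      (∀ s u, s ≤ u → F u ≤ F s) ∧ Envelope k f (t / 2) F ∧
      qnorm q (Ioi 0) (fun v => ENNReal.ofReal (v ^ (1 / p)) * F v) ≤ C * modulus k f p q t := by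
  by_cases hqt : q = ∞
  · subst hqt; exact envelope_top d p hp k
  · exact envelope_fin d p hp q hq hqt k

end

section

def WB {d : ℕ} (p : ℝ) (u : Euc d → ℝ) (M : ℝ) : Prop :=
  Measurable u ∧ ∀ E : Set (Euc d), MeasurableSet E → ∀ v : ℝ, 0 < v →
    volume E ≤ ENNReal.ofReal v → ∫⁻ x in E, ‖u x‖ₑ ≤ ENNReal.ofReal (v ^ (1 - 1 / p) * M)

theorem WB_of_lorentz (d : ℕ) (p : ℝ) (hp : 1 < p) (q : ℝ≥0∞) (hq : 0 < q) :
    ∃ C : ℝ, 0 ≤ C ∧ ∀ g : Euc d → ℝ, Measurable g → ∀ W : ℝ, 0 ≤ W →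
      lorentz volume g p q (Ioi 0) ≤ ENNReal.ofReal W → WB p g (C * W) := by
  obtain ⟨ρ, h1, h2, h3⟩ := exists_rho p hp
  obtain ⟨C, hC, H⟩ := PP_weak (d := d) p hp q hq ρ h3
  have hCr := Crho_ne_top h2
  refine ⟨(Crho ρ * C).toReal, ENNReal.toReal_nonneg, fun g hg W hW hgW => ⟨hg, ?_⟩⟩
  intro E hE v hv hEv
  refine (setL_le h1 h2 g hg E v hv hEv).trans ?_
  have hv1 : ENNReal.ofReal v = ENNReal.ofReal (v ^ (1 - 1 / p)) * ENNReal.ofReal (v ^ (1 / p)) := by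
    rw [← ENNReal.ofReal_mul (by positivity), ← Real.rpow_add hv]
    simp
  rw [hv1, ENNReal.ofReal_mul (by positivity), ENNReal.ofReal_mul ENNReal.toReal_nonneg,
    ENNReal.ofReal_toReal (ENNReal.mul_ne_top hCr hC)]
  calc Crho ρ * (ENNReal.ofReal (v ^ (1 - 1 / p)) * ENNReal.ofReal (v ^ (1 / p))) * PP ρ g v
      = ENNReal.ofReal (v ^ (1 - 1 / p)) * (Crho ρ * (ENNReal.ofReal (v ^ (1 / p)) * PP ρ g v)) := by
        ring
    _ ≤ ENNReal.ofReal (v ^ (1 - 1 / p)) * (Crho ρ * (C * ENNReal.ofReal W)) := by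
        refine mul_le_mul' le_rfl (mul_le_mul' le_rfl ((H g v hv).trans (mul_le_mul' le_rfl hgW)))
    _ = _ := by ring

theorem WB.shift {d : ℕ} {p : ℝ} {u : Euc d → ℝ} {M : ℝ} (h : WB p u M) (y : Euc d) :
    WB p (fun x => u (x + y)) M := by
  refine ⟨h.1.comp (measurable_add_const y), fun E hE v hv hEv => ?_⟩
  exact shift_bound u (ENNReal.ofReal v) _ (fun E' hE' h' => h.2 E' hE' v hv h') y E hE hEv

theorem WB.add {d : ℕ} {p : ℝ} {u w : Euc d → ℝ} {M N : ℝ} (h : WB p u M) (h' : WB p w N)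
    (hM : 0 ≤ M) (hN : 0 ≤ N) : WB p (fun x => u x + w x) (M + N) := by
  refine ⟨h.1.add h'.1, fun E hE v hv hEv => ?_⟩
  calc ∫⁻ x in E, ‖u x + w x‖ₑ ≤ ∫⁻ x in E, (‖u x‖ₑ + ‖w x‖ₑ) :=
        lintegral_mono fun x => enorm_add_le _ _
    _ = (∫⁻ x in E, ‖u x‖ₑ) + ∫⁻ x in E, ‖w x‖ₑ := lintegral_add_left h.1.enorm _
    _ ≤ _ := by
        rw [mul_add, ENNReal.ofReal_add (by positivity) (by positivity)]
        exact add_le_add (h.2 E hE v hv hEv) (h'.2 E hE v hv hEv)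

/-- the averaging operator occurring in the doubling identity -/
def sumOp {d : ℕ} (h : Euc d) (u : Euc d → ℝ) : Euc d → ℝ := fun x => u (x + h) + u x

theorem iterDiff_double {d : ℕ} (k : ℕ) (h : Euc d) (f : Euc d → ℝ) :
    iterDiff k ((2:ℝ) • h) f = (sumOp h)^[k] (iterDiff k h f) := by
  have h1 : diffOp (d := d) ((2:ℝ) • h) = sumOp h ∘ diffOp h := by
    ext u x
    simp only [diffOp, sumOp, Function.comp, two_smul, ← add_assoc]
    ring
  have h2 : Function.Commute (sumOp (d := d) h) (diffOp h) := by
    intro u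
    ext x
    simp only [diffOp, sumOp]
    ring
  rw [iterDiff, h1, h2.comp_iterate]
  rfl

theorem WB_sumOp {d : ℕ} {p : ℝ} (h : Euc d) (n : ℕ) : ∀ {u : Euc d → ℝ} {M : ℝ}, 0 ≤ M →
    WB p u M → WB p ((sumOp h)^[n] u) (2 ^ n * M) := by
  induction n with
  | zero => intro u M _ hu; simpa using hu
  | succ n ih =>
    intro u M hM hu
    rw [Function.iterate_succ_apply]
    have := ih (u := sumOp h u) (M := M + M) (by positivity) ((hu.shift h).add hu hM hM)
    convert this using 1
    ring

theorem WB_doubling {d : ℕ} {p : ℝ} (k : ℕ) (f : Euc d → ℝ) (L M : ℝ) (hM : 0 ≤ M)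
    (H : ∀ h : Euc d, ‖h‖ ≤ L → WB p (iterDiff k h f) M) (n : ℕ) :
    ∀ h : Euc d, ‖h‖ ≤ 2 ^ n * L → WB p (iterDiff k h f) (2 ^ (k * n) * M) := by
  induction n with
  | zero => intro h hh; simpa using H h (by simpa using hh)
  | succ n ih =>
    intro h hh
    have h1 : h = (2:ℝ) • ((2:ℝ)⁻¹ • h) := by simp
    have h2 : ‖(2:ℝ)⁻¹ • h‖ ≤ 2 ^ n * L := by
      rw [norm_smul]
      norm_num
      rw [pow_succ] at hh
      linarith
    have := WB_sumOp ((2:ℝ)⁻¹ • h) k (by positivity) (ih _ h2)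
    rw [← iterDiff_double, ← h1] at this
    convert this using 1
    rw [Nat.mul_succ, pow_add]; ring

theorem WB.loc {d : ℕ} {p : ℝ} {u : Euc d → ℝ} {M : ℝ} (h : WB p u M) :
    LocallyIntegrable u volume := by
  rw [locallyIntegrable_iff]
  intro K hK
  refine ⟨h.1.aestronglyMeasurable, ?_⟩
  refine lt_of_le_of_lt (h.2 K hK.measurableSet ((volume K).toReal + 1) (by positivity) ?_)
    ENNReal.ofReal_lt_top
  rw [ENNReal.ofReal_add ENNReal.toReal_nonneg (by norm_num), ENNReal.ofReal_toReal hK.measure_lt_top.ne]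
  exact le_self_add

end

section

/-- a normalized Lipschitz kernel supported in the unit ball -/
structure IsKer {d : ℕ} (φ : Euc d → ℝ) (K : ℝ) : Prop where
  nonneg : ∀ h, 0 ≤ φ h
  cont : Continuous φ
  supp : HasCompactSupport φ
  zero : ∀ h, 1 < ‖h‖ → φ h = 0
  int : ∫ h, φ h = 1
  lip : ∀ x y, |φ x - φ y| ≤ K * ‖x - y‖
  Kpos : 0 ≤ K

theorem exists_ker (d : ℕ) : ∃ (φ : Euc d → ℝ) (K : ℝ), IsKer φ K := by
  let b : ContDiffBump (0 : Euc d) := ⟨1 / 2, 1, by norm_num, by norm_num⟩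
  have hcs : HasCompactSupport (b.normed volume) := b.hasCompactSupport_normed
  have hcd : ContDiff ℝ 1 (b.normed volume) := b.contDiff_normed
  obtain ⟨K, hK⟩ := hcd.lipschitzWith_of_hasCompactSupport hcs (by norm_num)
  refine ⟨b.normed volume, K, ⟨fun h => b.nonneg_normed h, hcd.continuous, hcs, ?_,
    b.integral_normed, ?_, K.2⟩⟩
  · intro h hh
    by_contra hne
    have : h ∈ Function.support (b.normed volume) := hne
    rw [b.support_normed_eq] at this
    simp only [Metric.mem_ball, dist_zero_right] at this
    have h1 : b.rOut = 1 := rfl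
    linarith
  · intro x y
    have := hK.dist_le_mul x y
    rwa [Real.dist_eq, dist_eq_norm] at this

def aOp {d : ℕ} (φ : Euc d → ℝ) (l : ℝ) (u : Euc d → ℝ) : Euc d → ℝ :=
  fun x => ∫ h, φ h * u (x + l • h)

variable {d : ℕ} {φ : Euc d → ℝ} {K : ℝ}

theorem ker_arg (x h : Euc d) {l : ℝ} (hl : 0 < l) : l⁻¹ • (x + l • h - x) = h := by
  rw [add_sub_cancel_left, smul_smul, inv_mul_cancel₀ hl.ne', one_smul]

theorem IsKer.integrable_sh (hφ : IsKer φ K) {u : Euc d → ℝ} (hu : LocallyIntegrable u volume)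
    {l : ℝ} (hl : 0 < l) (x : Euc d) :
    Integrable (fun z => φ (l⁻¹ • (z - x)) * u z) volume := by
  have hc : Continuous fun z : Euc d => φ (l⁻¹ • (z - x)) :=
    hφ.cont.comp (by fun_prop)
  have hs : HasCompactSupport fun z : Euc d => φ (l⁻¹ • (z - x)) := by
    refine HasCompactSupport.of_support_subset_isCompact (isCompact_closedBall x l) ?_
    intro z hz
    by_contra hn
    refine hz (hφ.zero _ ?_)
    rw [Metric.mem_closedBall, dist_eq_norm, not_le] at hn
    rw [norm_smul, norm_inv, Real.norm_of_nonneg hl.le, ← div_eq_inv_mul, one_lt_div hl]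
    exact hn
  exact hu.integrable_smul_left_of_hasCompactSupport hc hs

theorem IsKer.integrable (hφ : IsKer φ K) {u : Euc d → ℝ} (hu : LocallyIntegrable u volume)
    {l : ℝ} (hl : 0 < l) (x : Euc d) :
    Integrable (fun h => φ h * u (x + l • h)) volume := by
  have h1 := (hφ.integrable_sh hu hl x).comp_add_left x
  have h2 := h1.comp_smul hl.ne'
  simpa only [ker_arg x _ hl] using h2

theorem IsKer.aOp_eq (hφ : IsKer φ K) (u : Euc d → ℝ)
    {l : ℝ} (hl : 0 < l) (x : Euc d) :
    aOp φ l u x = (l ^ d)⁻¹ * ∫ z, φ (l⁻¹ • (z - x)) * u z := by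
  have h1 := Measure.integral_comp_smul (volume : Measure (Euc d))
    (fun y => φ (l⁻¹ • (x + y - x)) * u (x + y)) l
  simp only [ker_arg x _ hl] at h1
  rw [integral_add_left_eq_self (fun y => φ (l⁻¹ • (y - x)) * u y) x] at h1
  rw [aOp, h1, smul_eq_mul, abs_of_pos (by positivity)]
  simp

theorem IsKer.aOp_sub (hφ : IsKer φ K) {u w : Euc d → ℝ} (hu : LocallyIntegrable u volume)
    (hw : LocallyIntegrable w volume) {l : ℝ} (hl : 0 < l) (x : Euc d) :
    aOp φ l (fun z => u z - w z) x = aOp φ l u x - aOp φ l w x := by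
  simp only [aOp, mul_sub]
  exact integral_sub (hφ.integrable hu hl x) (hφ.integrable hw hl x)

def Lip (u : Euc d → ℝ) (ℓ : ℝ) : Prop := ∀ x y, |u x - u y| ≤ ℓ * ‖x - y‖

theorem Lip.cont {u : Euc d → ℝ} {ℓ : ℝ} (h : Lip u ℓ) : Continuous u := by
  refine (LipschitzWith.of_dist_le_mul (K := ℓ.toNNReal) fun x y => ?_).continuous
  rw [Real.dist_eq, dist_eq_norm]
  refine (h x y).trans ?_
  gcongr
  exact Real.le_coe_toNNReal ℓ

theorem IsKer.integrable0 (hφ : IsKer φ K) : Integrable φ volume :=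
  hφ.cont.integrable_of_hasCompactSupport hφ.supp

theorem IsKer.aOp_lip (hφ : IsKer φ K) {u : Euc d → ℝ} {ℓ : ℝ} (hu : Lip u ℓ)
    {l : ℝ} (hl : 0 < l) : Lip (aOp φ l u) ℓ := by
  intro x y
  have hloc : LocallyIntegrable u volume := hu.cont.locallyIntegrable
  have : aOp φ l u x - aOp φ l u y = ∫ h, φ h * (u (x + l • h) - u (y + l • h)) := by
    simp only [aOp, mul_sub]
    exact (integral_sub (hφ.integrable hloc hl x) (hφ.integrable hloc hl y)).symm
  rw [this, ← Real.norm_eq_abs]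
  calc ‖∫ h, φ h * (u (x + l • h) - u (y + l • h))‖ ≤ ∫ h, φ h * (ℓ * ‖x - y‖) := by
        refine norm_integral_le_of_norm_le (hφ.integrable0.mul_const _) (Eventually.of_forall fun h => ?_)
        rw [norm_mul, Real.norm_of_nonneg (hφ.nonneg h), Real.norm_eq_abs]
        refine mul_le_mul_of_nonneg_left ((hu _ _).trans (le_of_eq ?_)) (hφ.nonneg h)
        congr 2; abel
    _ = ℓ * ‖x - y‖ := by rw [integral_mul_const, hφ.int, one_mul]

theorem IsKer.aOp_wb (hφ : IsKer φ K) {p : ℝ} (hp : 1 < p) {u : Euc d → ℝ} {M : ℝ} (hM : 0 ≤ M) (hu : WB p u M)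
    {l : ℝ} (hl : 0 < l) : Lip (aOp φ l u)
      ((K * (2 * (volume (Metric.closedBall (0 : Euc d) 1)).toReal) ^ (1 - 1 / p)) *
        (l⁻¹ * (l ^ d) ^ (- (1 / p)) * M)) := by
  intro x y
  set V := (volume (Metric.closedBall (0 : Euc d) 1)).toReal with hV
  have hVpos : 0 < V := ENNReal.toReal_pos (Metric.measure_closedBall_pos volume _ one_pos).ne'
    measure_closedBall_lt_top.ne
  have hVol : ∀ z : Euc d, volume (Metric.closedBall z l) = ENNReal.ofReal (l ^ d * V) := by
    intro z
    rw [Measure.addHaar_closedBall' _ _ hl.le, finrank_euclideanSpace_fin,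
      ENNReal.ofReal_mul (by positivity), hV, ENNReal.ofReal_toReal measure_closedBall_lt_top.ne]
  set E := Metric.closedBall x l ∪ Metric.closedBall y l with hE
  have hEm : MeasurableSet E := measurableSet_closedBall.union measurableSet_closedBall
  have hEv : volume E ≤ ENNReal.ofReal (l ^ d * (2 * V)) := by
    refine (measure_union_le _ _).trans ?_
    rw [hVol, hVol, ← ENNReal.ofReal_add (by positivity) (by positivity)]
    exact ENNReal.ofReal_le_ofReal (by linarith)
  have hI := hu.2 E hEm (l ^ d * (2 * V)) (by positivity) hEv
  have hloc := hu.loc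
  have hEi : IntegrableOn u E volume :=
    ⟨hu.1.aestronglyMeasurable, lt_of_le_of_lt hI ENNReal.ofReal_lt_top⟩
  have hEn : ∫ z in E, ‖u z‖ ≤ (l ^ d * (2 * V)) ^ (1 - 1 / p) * M := by
    rw [integral_norm_eq_lintegral_enorm hu.1.aestronglyMeasurable]
    exact ENNReal.toReal_le_of_le_ofReal (by positivity) hI
  rw [hφ.aOp_eq u hl, hφ.aOp_eq u hl, ← mul_sub,
    ← integral_sub (hφ.integrable_sh hloc hl x) (hφ.integrable_sh hloc hl y), abs_mul,
    abs_of_pos (by positivity : 0 < (l ^ d)⁻¹), ← Real.norm_eq_abs (∫ _, _)]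
  have key : ‖∫ z, (φ (l⁻¹ • (z - x)) * u z - φ (l⁻¹ • (z - y)) * u z)‖ ≤
      ∫ z, E.indicator (fun z => K * (l⁻¹ * ‖x - y‖) * ‖u z‖) z := by
    refine norm_integral_le_of_norm_le ?_ (Eventually.of_forall fun z => ?_)
    · rw [integrable_indicator_iff hEm]
      exact hEi.norm.const_mul _
    · have hout : ∀ w : Euc d, z ∉ Metric.closedBall w l → φ (l⁻¹ • (z - w)) = 0 := by
        intro w hn
        refine hφ.zero _ ?_
        rw [Metric.mem_closedBall, dist_eq_norm, not_le] at hn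
        rw [norm_smul, norm_inv, Real.norm_of_nonneg hl.le, ← div_eq_inv_mul, one_lt_div hl]
        exact hn
      by_cases hz : z ∈ E
      · rw [indicator_of_mem hz, ← sub_mul, norm_mul, Real.norm_eq_abs]
        gcongr
        refine (hφ.lip _ _).trans (mul_le_mul_of_nonneg_left (le_of_eq ?_) hφ.Kpos)
        rw [← smul_sub, norm_smul, norm_inv, Real.norm_of_nonneg hl.le, norm_sub_rev x y]
        congr 2; abel
      · rw [indicator_of_notMem hz]
        rw [hE, mem_union, not_or] at hz
        rw [hout x hz.1, hout y hz.2]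
        simp
  rw [integral_indicator hEm, integral_const_mul] at key
  have hfin : (l ^ d)⁻¹ * (l ^ d * (2 * V)) ^ (1 - 1 / p) =
      (2 * V) ^ (1 - 1 / p) * (l ^ d) ^ (- (1 / p)) := by
    rw [Real.mul_rpow (by positivity) (by positivity), ← mul_assoc, ← Real.rpow_neg_one (l ^ d),
      ← Real.rpow_add (by positivity), mul_comm]
    congr 2; ring
  calc (l ^ d)⁻¹ * ‖∫ z, (φ (l⁻¹ • (z - x)) * u z - φ (l⁻¹ • (z - y)) * u z)‖
      ≤ (l ^ d)⁻¹ * (K * (l⁻¹ * ‖x - y‖) * ((l ^ d * (2 * V)) ^ (1 - 1 / p) * M)) := by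
        have := hφ.Kpos
        refine mul_le_mul_of_nonneg_left (key.trans ?_) (by positivity)
        exact mul_le_mul_of_nonneg_left hEn (by positivity)
    _ = ((l ^ d)⁻¹ * (l ^ d * (2 * V)) ^ (1 - 1 / p)) * (K * (l⁻¹ * ‖x - y‖) * M) := by ring
    _ = _ := by rw [hfin]; ring

end

section

def tOp {d : ℕ} (k : ℕ) (φ : Euc d → ℝ) (L : ℝ) (u : Euc d → ℝ) : Euc d → ℝ :=
  fun x => -(-1) ^ k * ∑ j ∈ Finset.range k, sgc k (j + 1) * aOp φ (((j : ℝ) + 1) * L) u x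

variable {d : ℕ} {φ : Euc d → ℝ} {K : ℝ}

theorem sum_sgc (k : ℕ) : ∑ j ∈ Finset.range k, |sgc k (j + 1)| ≤ 2 ^ k := by
  have h1 : ∀ j, |sgc k j| = (k.choose j : ℝ) := by
    intro j
    rw [sgc, abs_mul, abs_pow, abs_neg, abs_one, one_pow, one_mul, Nat.abs_cast]
  have h2 : ∑ j ∈ Finset.range (k + 1), |sgc k j| = 2 ^ k := by
    simp only [h1]
    exact_mod_cast Nat.sum_range_choose k
  rw [Finset.sum_range_succ'] at h2
  have := abs_nonneg (sgc k 0)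
  linarith

theorem IsKer.sub_tOp (hφ : IsKer φ K) (k : ℕ) {u : Euc d → ℝ} (hu : LocallyIntegrable u volume)
    {L : ℝ} (hL : 0 < L) (x : Euc d) :
    u x - tOp k φ L u x = (-1) ^ k * ∫ h, φ h * iterDiff k (L • h) u x := by
  have h1 : ∫ h, φ h * iterDiff k (L • h) u x = (-1) ^ k * u x +
      ∑ j ∈ Finset.range k, sgc k (j + 1) * aOp φ (((j : ℝ) + 1) * L) u x := by
    have h2 : ∀ h : Euc d, φ h * iterDiff k (L • h) u x =
        (-1) ^ k * u x * φ h + ∑ j ∈ Finset.range k, sgc k (j + 1) *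
          (φ h * u (x + (((j : ℝ) + 1) * L) • h)) := by
      intro h
      rw [iterDiff_sum, Finset.sum_range_succ', add_comm, mul_add, Finset.mul_sum]
      congr 1
      · simp [sgc]; ring
      · refine Finset.sum_congr rfl fun j _ => ?_
        rw [smul_smul]; push_cast; ring
    simp only [h2]
    have hint : ∀ j ∈ Finset.range k, Integrable (fun h => sgc k (j + 1) *
          (φ h * u (x + (((j : ℝ) + 1) * L) • h))) volume := fun j _ =>
      (hφ.integrable hu (by positivity) x).const_mul _
    rw [integral_add (hφ.integrable0.const_mul _) (integrable_finsetSum _ hint),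
      integral_finsetSum _ hint, integral_const_mul, hφ.int, mul_one]
    simp only [integral_const_mul, aOp]
  rw [h1, tOp, mul_add, ← mul_assoc, ← mul_pow]
  simp; 

theorem IsKer.tOp_err (hφ : IsKer φ K) (k : ℕ) {u : Euc d → ℝ} (hum : Measurable u)
    (hu : LocallyIntegrable u volume)
    {L : ℝ} (hL : 0 < L) (E : Set (Euc d)) (X : ℝ≥0∞)
    (H : ∀ c : Euc d, ‖c‖ ≤ L → ∫⁻ x in E, ‖iterDiff k c u x‖ₑ ≤ X) :
    ∫⁻ x in E, ‖u x - tOp k φ L u x‖ₑ ≤ X := by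
  have hmeas : Measurable (Function.uncurry fun (x h : Euc d) => ‖φ h * iterDiff k (L • h) u x‖ₑ) := by
    have h1 : Measurable fun z : Euc d × Euc d => iterDiff k (L • z.2) u z.1 := by
      have h3 : Measurable fun z : Euc d × Euc d => (L • z.2, z.1) := by fun_prop
      exact (iterDiff_meas k u hum).comp h3
    have h2 : Measurable fun z : Euc d × Euc d => φ z.2 := hφ.cont.measurable.comp measurable_snd
    exact (h2.mul h1).enorm
  calc ∫⁻ x in E, ‖u x - tOp k φ L u x‖ₑ
      ≤ ∫⁻ x in E, ∫⁻ h, ‖φ h * iterDiff k (L • h) u x‖ₑ := by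
        refine lintegral_mono fun x => ?_
        rw [hφ.sub_tOp k hu hL x, enorm_mul, enorm_pow]
        simp only [enorm_neg, enorm_one, one_pow, one_mul]
        exact enorm_integral_le_lintegral_enorm _
    _ = ∫⁻ h, ∫⁻ x in E, ‖φ h * iterDiff k (L • h) u x‖ₑ :=
        lintegral_lintegral_swap hmeas.aemeasurable
    _ ≤ ∫⁻ h, ‖φ h‖ₑ * X := by
        refine lintegral_mono fun h => ?_
        simp only [enorm_mul]
        rw [lintegral_const_mul' _ _ enorm_ne_top]
        by_cases hh : 1 < ‖h‖
        · rw [hφ.zero h hh]; simp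
        · refine mul_le_mul' le_rfl (H _ ?_)
          rw [norm_smul, Real.norm_of_nonneg hL.le]
          nlinarith [not_lt.1 hh]
    _ = X := by
        rw [lintegral_mul_const _ hφ.cont.measurable.enorm]
        have : ∫⁻ h, ‖φ h‖ₑ = 1 := by
          rw [← ofReal_integral_norm_eq_lintegral_enorm hφ.integrable0]
          have : ∀ h, ‖φ h‖ = φ h := fun h => Real.norm_of_nonneg (hφ.nonneg h)
          simp only [this, hφ.int, ENNReal.ofReal_one]
        rw [this, one_mul]

theorem tOp_lip_aux (k : ℕ) {u : Euc d → ℝ} {ℓ : ℝ} (hℓ : 0 ≤ ℓ) {L : ℝ}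
    (H : ∀ j : ℕ, Lip (aOp φ (((j : ℝ) + 1) * L) u) ℓ) : Lip (tOp k φ L u) (2 ^ k * ℓ) := by
  intro x y
  rw [tOp, tOp, ← mul_sub, ← Finset.sum_sub_distrib, abs_mul, abs_neg, abs_pow, abs_neg, abs_one,
    one_pow, one_mul]
  refine (Finset.abs_sum_le_sum_abs _ _).trans ?_
  calc ∑ j ∈ Finset.range k, |sgc k (j + 1) * aOp φ (((j : ℝ) + 1) * L) u x -
          sgc k (j + 1) * aOp φ (((j : ℝ) + 1) * L) u y|
      ≤ ∑ j ∈ Finset.range k, |sgc k (j + 1)| * (ℓ * ‖x - y‖) := by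
        refine Finset.sum_le_sum fun j _ => ?_
        rw [← mul_sub, abs_mul]
        exact mul_le_mul_of_nonneg_left (H j x y) (abs_nonneg _)
    _ ≤ 2 ^ k * (ℓ * ‖x - y‖) := by
        rw [← Finset.sum_mul]
        exact mul_le_mul_of_nonneg_right (sum_sgc k) (by positivity)
    _ = _ := by ring

theorem IsKer.tOp_lip (hφ : IsKer φ K) (k : ℕ) {u : Euc d → ℝ} {ℓ : ℝ} (hℓ : 0 ≤ ℓ) (hu : Lip u ℓ)
    {L : ℝ} (hL : 0 < L) : Lip (tOp k φ L u) (2 ^ k * ℓ) :=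
  tOp_lip_aux k hℓ fun _ => hφ.aOp_lip hu (by positivity)

/-- the constant in the Lipschitz estimate -/
def CK (d : ℕ) (K p : ℝ) : ℝ :=
  K * (2 * (volume (Metric.closedBall (0 : Euc d) 1)).toReal) ^ (1 - 1 / p)

theorem CK_nonneg {d : ℕ} {K p : ℝ} (hK : 0 ≤ K) : 0 ≤ CK d K p := by
  unfold CK; positivity

theorem IsKer.tOp_wb (hφ : IsKer φ K) (k : ℕ) {p : ℝ} (hp : 1 < p) {u : Euc d → ℝ} {M : ℝ}
    (hM : 0 ≤ M) (hu : WB p u M) {L : ℝ} (hL : 0 < L) :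
    Lip (tOp k φ L u) (2 ^ k * (CK d K p * (L⁻¹ * (L ^ d) ^ (-(1 / p)) * M))) := by
  have hC : 0 ≤ CK d K p := CK_nonneg hφ.Kpos
  refine tOp_lip_aux k (by positivity) fun j => ?_
  have hj : L ≤ ((j : ℝ) + 1) * L := by nlinarith [Nat.cast_nonneg (α := ℝ) j]
  intro x y
  refine (hφ.aOp_wb hp hM hu (l := ((j : ℝ) + 1) * L) (by positivity) x y).trans ?_
  refine mul_le_mul_of_nonneg_right ?_ (norm_nonneg _)
  refine mul_le_mul_of_nonneg_left ?_ hC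
  refine mul_le_mul_of_nonneg_right ?_ hM
  refine mul_le_mul (inv_anti₀ hL hj) ?_ (by positivity) (by positivity)
  refine Real.rpow_le_rpow_of_nonpos (by positivity) (by gcongr) ?_
  have : 0 ≤ 1 / p := by positivity
  linarith

theorem IsKer.tOp_sub (hφ : IsKer φ K) (k : ℕ) {u w : Euc d → ℝ} (hu : LocallyIntegrable u volume)
    (hw : LocallyIntegrable w volume) {L : ℝ} (hL : 0 < L) (x : Euc d) :
    tOp k φ L (fun z => u z - w z) x = tOp k φ L u x - tOp k φ L w x := by
  simp only [tOp]
  rw [← mul_sub, ← Finset.sum_sub_distrib]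
  congr 1
  refine Finset.sum_congr rfl fun j _ => ?_
  rw [hφ.aOp_sub hu hw (by positivity), mul_sub]

theorem IsKer.tOp_errWB (hφ : IsKer φ K) (k : ℕ) {p : ℝ} (hp : 1 < p) {u : Euc d → ℝ} {M M' : ℝ}
    (hM' : 0 ≤ M') (hu : WB p u M') {L : ℝ} (hL : 0 < L)
    (H : ∀ c : Euc d, ‖c‖ ≤ L → WB p (iterDiff k c u) M) :
    WB p (fun x => u x - tOp k φ L u x) M := by
  refine ⟨hu.1.sub (hφ.tOp_wb k hp hM' hu hL).cont.measurable, fun E hE v hv hEv => ?_⟩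
  exact hφ.tOp_err k hu.1 hu.loc hL E _ fun c hc => (H c hc).2 E hE v hv hEv

end

section

variable {d : ℕ} {φ : Euc d → ℝ} {K : ℝ}

theorem scale_ineq (d : ℕ) (p : ℝ) (hp : 1 < p) (k : ℕ) (hk : (k : ℝ) ≤ (d : ℝ) / p) (L0 : ℝ)
    (hL : 0 < L0) (n : ℕ) :
    ((2 ^ n * L0) ^ d) ^ (-(1 / p)) * 2 ^ (k * n) ≤ (L0 ^ d) ^ (-(1 / p)) := by
  have h1 : ((2 ^ n * L0) ^ d) ^ (-(1 / p)) = ((2:ℝ) ^ (n * d)) ^ (-(1 / p)) * (L0 ^ d) ^ (-(1 / p)) := by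
    rw [mul_pow, Real.mul_rpow (by positivity) (by positivity), ← pow_mul]
  rw [h1]
  have h2 : ((2:ℝ) ^ (n * d)) ^ (-(1 / p)) * 2 ^ (k * n) ≤ 1 := by
    rw [← Real.rpow_natCast 2 (n * d), ← Real.rpow_natCast 2 (k * n), ← Real.rpow_mul (by norm_num),
      ← Real.rpow_add (by norm_num)]
    refine Real.rpow_le_one_of_one_le_of_nonpos (by norm_num) ?_
    push_cast
    have : (n : ℝ) * (k : ℝ) ≤ n * (d / p) := by gcongr
    have h3 : (n : ℝ) * d * -(1 / p) = - (n * (d / p)) := by ring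
    rw [h3]; linarith
  calc _ = (((2:ℝ) ^ (n * d)) ^ (-(1 / p)) * 2 ^ (k * n)) * (L0 ^ d) ^ (-(1 / p)) := by ring
    _ ≤ 1 * (L0 ^ d) ^ (-(1 / p)) := by gcongr
    _ = _ := one_mul _

def CA (d : ℕ) (K p : ℝ) (k : ℕ) : ℝ := 2 ^ k * CK d K p * 2 ^ (k * (k + 1))

theorem CA_nonneg {d : ℕ} {K p : ℝ} {k : ℕ} (hK : 0 ≤ K) : 0 ≤ CA d K p k := by
  have := CK_nonneg (d := d) (p := p) hK
  unfold CA; positivity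

theorem recursion (hφ : IsKer φ K) (k : ℕ) {p : ℝ} (hp : 1 < p) (hk : (k : ℝ) ≤ (d : ℝ) / p)
    {f : Euc d → ℝ} {Mf M0 L0 : ℝ} (hMf : 0 ≤ Mf) (hf : WB p f Mf) (hM0 : 0 ≤ M0) (hL0 : 0 < L0)
    (H0 : ∀ h : Euc d, ‖h‖ ≤ L0 → WB p (iterDiff k h f) M0) (m : ℕ) :
    Lip (tOp k φ (2 ^ ((k + 1) * m) * L0) f)
      (2 * CA d K p k * ((L0 ^ d) ^ (-(1 / p)) * M0) / (2 ^ ((k + 1) * m) * L0)) := by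
  have hCK : 0 ≤ CK d K p := CK_nonneg hφ.Kpos
  have hCA : 0 ≤ CA d K p k := CA_nonneg hφ.Kpos
  set B := (L0 ^ d) ^ (-(1 / p)) * M0 with hB
  have hB0 : 0 ≤ B := by positivity
  set X := 2 ^ k * CK d K p * ((L0 ^ d) ^ (-(1 / p)) * Mf) with hX
  have hX0 : 0 ≤ X := by positivity
  have main : ∀ J m : ℕ, Lip (tOp k φ (2 ^ ((k + 1) * m) * L0) f)
      ((2 * CA d K p k * B + X / 2 ^ J) / (2 ^ ((k + 1) * m) * L0)) := by
    intro J
    induction J with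
    | zero =>
      intro m x y
      refine (hφ.tOp_wb k hp hMf hf (L := 2 ^ ((k + 1) * m) * L0) (by positivity) x y).trans ?_
      refine mul_le_mul_of_nonneg_right ?_ (norm_nonneg _)
      rw [pow_zero, div_one, add_div]
      have h1 : ((2 ^ ((k + 1) * m) * L0) ^ d) ^ (-(1 / p)) ≤ (L0 ^ d) ^ (-(1 / p)) := by
        refine le_trans ?_ (scale_ineq d p hp k hk L0 hL0 ((k + 1) * m))
        exact le_mul_of_one_le_right (by positivity) (one_le_pow₀ (by norm_num))
      have h2 : 0 ≤ 2 * CA d K p k * B / (2 ^ ((k + 1) * m) * L0) := by positivity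
      refine le_trans ?_ (le_add_of_nonneg_left h2)
      rw [hX]
      generalize ((2 ^ ((k + 1) * m) * L0) ^ d) ^ (-(1 / p)) = A at h1 ⊢
      generalize (L0 ^ d) ^ (-(1 / p)) = A0 at h1 ⊢
      have h3 : 0 ≤ 2 ^ k * CK d K p * Mf * (2 ^ ((k + 1) * m) * L0)⁻¹ := by positivity
      have h4 := mul_le_mul_of_nonneg_left h1 h3
      rw [div_eq_mul_inv]
      generalize (2 ^ ((k + 1) * m) * L0)⁻¹ = Z at h4 ⊢
      linarith
    | succ J ih =>
      intro m x y
      set n := (k + 1) * m with hn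
      have hn1 : (k + 1) * (m + 1) = n + (k + 1) := by rw [hn]; ring
      set L := 2 ^ n * L0 with hL
      have hLpos : 0 < L := by positivity
      set L' := 2 ^ ((k + 1) * (m + 1)) * L0 with hL'
      have hLL : L' = 2 ^ (k + 1) * L := by rw [hL', hn1, pow_add, hL]; ring
      have hL'pos : 0 < L' := by positivity
      set g := tOp k φ L' f with hg
      have hgl : Lip g ((2 * CA d K p k * B + X / 2 ^ J) / L') := ih (m + 1)
      have hw : WB p (fun x => f x - g x) (2 ^ (k * ((k + 1) * (m + 1))) * M0) :=
        hφ.tOp_errWB k hp hMf hf hL'pos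
          (WB_doubling k f L0 M0 hM0 H0 ((k + 1) * (m + 1)))
      have h1 := hφ.tOp_wb k hp (by positivity) hw hLpos x y
      have h2 := hφ.tOp_lip k (by positivity) hgl hLpos x y
      have h3 : ∀ z, tOp k φ L f z = tOp k φ L (fun x => f x - g x) z + tOp k φ L g z := by
        intro z
        rw [hφ.tOp_sub k hf.loc hgl.cont.locallyIntegrable hLpos]; ring
      rw [h3 x, h3 y]
      have h4 : (2 ^ k * (CK d K p * (L⁻¹ * (L ^ d) ^ (-(1 / p)) *
          (2 ^ (k * ((k + 1) * (m + 1))) * M0)))) ≤ CA d K p k * B / L := by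
        have h5 := scale_ineq d p hp k hk L0 hL0 n
        rw [← hL] at h5
        have h6 : (2:ℝ) ^ (k * ((k + 1) * (m + 1))) = 2 ^ (k * n) * 2 ^ (k * (k + 1)) := by
          rw [hn1, mul_add, pow_add]
        rw [h6, CA, hB]
        have h9 : 0 ≤ 2 ^ k * CK d K p * 2 ^ (k * (k + 1)) * M0 * L⁻¹ := by positivity
        have h10 := mul_le_mul_of_nonneg_left h5 h9
        generalize (L ^ d) ^ (-(1 / p)) = A at h10 ⊢
        generalize (L0 ^ d) ^ (-(1 / p)) = A0 at h10 ⊢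
        rw [div_eq_mul_inv]
        generalize L⁻¹ = Z at h10 ⊢
        generalize (2:ℝ) ^ (k * n) = z1 at h10 ⊢
        generalize (2:ℝ) ^ (k * (k + 1)) = z2 at h10 ⊢
        linarith
      have h7 : 2 ^ k * ((2 * CA d K p k * B + X / 2 ^ J) / L') =
          (CA d K p k * B + X / 2 ^ (J + 1)) / L := by
        rw [hLL]
        field_simp
        ring
      rw [h7] at h2
      have h8 := mul_le_mul_of_nonneg_right h4 (norm_nonneg (x - y))
      calc _ = |(tOp k φ L (fun x => f x - g x) x - tOp k φ L (fun x => f x - g x) y) +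
              (tOp k φ L g x - tOp k φ L g y)| := by congr 1; ring
        _ ≤ CA d K p k * B / L * ‖x - y‖ + (CA d K p k * B + X / 2 ^ (J + 1)) / L * ‖x - y‖ :=
            (abs_add_le _ _).trans (add_le_add (h1.trans h8) h2)
        _ = _ := by ring
  intro x y
  have ht : Tendsto (fun J : ℕ => (2 * CA d K p k * B + X / 2 ^ J) / (2 ^ ((k + 1) * m) * L0) * ‖x - y‖)
      atTop (nhds ((2 * CA d K p k * B + 0) / (2 ^ ((k + 1) * m) * L0) * ‖x - y‖)) := by
    refine Tendsto.mul_const _ (Tendsto.div_const (Tendsto.const_add _ ?_) _)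
    have := (tendsto_pow_atTop_nhds_zero_of_lt_one (r := (1/2 : ℝ)) (by norm_num) (by norm_num)).const_mul X
    rw [mul_zero] at this
    refine this.congr fun J => ?_
    rw [one_div, inv_pow, div_eq_mul_inv]
  rw [add_zero] at ht
  exact ge_of_tendsto' ht fun J => main J m x y

end

section

variable {d : ℕ} {φ : Euc d → ℝ} {K : ℝ}

theorem cubeSet_eq (a : Fin d → ℝ) (l : ℝ) :
    cubeSet a l = (WithLp.ofLp : Euc d → (Fin d → ℝ)) ⁻¹' (Icc a (fun i => a i + l)) := by
  ext x
  simp only [cubeSet, mem_setOf_eq, mem_preimage, mem_Icc, Pi.le_def]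
  exact forall_and

theorem cubeSet_closed (a : Fin d → ℝ) (l : ℝ) : IsClosed (cubeSet a l) := by
  rw [cubeSet_eq]
  exact isClosed_Icc.preimage (PiLp.continuous_ofLp 2 _)

theorem cubeSet_vol (a : Fin d → ℝ) (l : ℝ) (hl : 0 ≤ l) :
    volume (cubeSet a l) = ENNReal.ofReal (l ^ d) := by
  rw [cubeSet_eq, (PiLp.volume_preserving_ofLp (Fin d)).measure_preimage
    measurableSet_Icc.nullMeasurableSet, Real.volume_Icc_pi]
  simp [ENNReal.ofReal_pow hl]

theorem cubeSet_dist (a : Fin d → ℝ) (l : ℝ) (hl : 0 ≤ l) (x y : Euc d) (hx : x ∈ cubeSet a l)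
    (hy : y ∈ cubeSet a l) : ‖x - y‖ ≤ d * l := by
  rw [EuclideanSpace.norm_eq]
  refine Real.sqrt_le_iff.2 ⟨by positivity, ?_⟩
  have h1 : ∀ i, ‖(x - y) i‖ ^ 2 ≤ l ^ 2 := by
    intro i
    have h1 := hx i
    have h2 := hy i
    rw [Real.norm_eq_abs]
    refine pow_le_pow_left₀ (abs_nonneg _) ?_ 2
    rw [PiLp.sub_apply, abs_le]
    constructor <;> linarith
  refine (Finset.sum_le_sum fun i _ => h1 i).trans ?_
  simp only [Finset.sum_const, Finset.card_univ, Fintype.card_fin, nsmul_eq_mul]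
  rw [mul_pow]
  refine mul_le_mul_of_nonneg_right ?_ (by positivity)
  have : d ≤ d ^ 2 := Nat.le_self_pow (by norm_num) d
  exact_mod_cast this

theorem cubeSet_compact (a : Fin d → ℝ) (l : ℝ) (hl : 0 ≤ l) : IsCompact (cubeSet a l) := by
  refine Metric.isCompact_of_isClosed_isBounded (cubeSet_closed a l) ?_
  rw [Metric.isBounded_iff]
  exact ⟨d * l, fun x hx y hy => by rw [dist_eq_norm]; exact cubeSet_dist a l hl x y hx hy⟩

theorem cubeSet_corner (a : Fin d → ℝ) (l : ℝ) (hl : 0 ≤ l) : WithLp.toLp 2 a ∈ cubeSet a l := by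
  intro i
  simp [hl]

theorem osc_real {f g : Euc d → ℝ} (hf : LocallyIntegrable f volume) (hg : Continuous g)
    (a : Fin d → ℝ) (l : ℝ) (hl : 0 < l) (D : ℝ)
    (hD : ∀ x ∈ cubeSet a l, |g x - g (WithLp.toLp 2 a)| ≤ D) :
    ENNReal.ofReal (⨍ y in cubeSet a l, |f y - ⨍ z in cubeSet a l, f z|) * ENNReal.ofReal (l ^ d) ≤
      2 * (∫⁻ x in cubeSet a l, ‖f x - g x‖ₑ) + ENNReal.ofReal (2 * D) * ENNReal.ofReal (l ^ d) := by
  set Q := cubeSet a l with hQ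
  have hQc : IsCompact Q := cubeSet_compact a l hl.le
  have hQm : MeasurableSet Q := hQc.measurableSet
  have hfQ : IntegrableOn f Q volume := (locallyIntegrable_iff.1 hf) Q hQc
  have hgQ : IntegrableOn g Q volume := hg.continuousOn.integrableOn_compact hQc
  have hvol : volume Q = ENNReal.ofReal (l ^ d) := cubeSet_vol a l hl.le
  have hV : volume.real Q = l ^ d := by
    rw [Measure.real, hvol, ENNReal.toReal_ofReal (by positivity)]
  have hVpos : 0 < l ^ d := by positivity
  have hfin : volume Q ≠ ∞ := by rw [hvol]; simp
  have hc : ∀ c : ℝ, IntegrableOn (fun _ => c) Q volume := fun c => integrableOn_const hfin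
  set c := g (WithLp.toLp 2 a) with hcdef
  set A := ⨍ z in Q, f z with hA
  have hi1 : ∀ c : ℝ, IntegrableOn (fun x => |f x - c|) Q volume := fun c => (hfQ.sub (hc c)).abs
  have hi0 : IntegrableOn (fun x => f x - g x) Q volume := hfQ.sub hgQ
  have hi2 : IntegrableOn (fun x => |f x - g x|) Q volume := hi0.abs
  have hAeq : l ^ d * A = ∫ z in Q, f z := by
    rw [hA, setAverage_eq, hV, smul_eq_mul, mul_inv_cancel_left₀ hVpos.ne']
  have h1 : l ^ d * |c - A| ≤ ∫ x in Q, |f x - c| := by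
    have : l ^ d * (c - A) = ∫ x in Q, (c - f x) := by
      rw [integral_sub (hc c) hfQ, mul_sub, hAeq, setIntegral_const, hV, smul_eq_mul]
    rw [show l ^ d * |c - A| = |l ^ d * (c - A)| by rw [abs_mul, abs_of_pos hVpos], this]
    refine (abs_integral_le_integral_abs).trans (le_of_eq ?_)
    congr 1; ext x; exact abs_sub_comm _ _
  have h2 : ∫ x in Q, |f x - A| ≤ (∫ x in Q, |f x - c|) + l ^ d * |c - A| := by
    calc ∫ x in Q, |f x - A| ≤ ∫ x in Q, (|f x - c| + |c - A|) := by
          refine integral_mono (hfQ.sub (hc A)).abs (((hfQ.sub (hc c)).abs).add (hc _)) fun x => ?_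
          exact abs_sub_le _ _ _
      _ = _ := by
          rw [integral_add (hi1 c) (hc _), setIntegral_const, hV, smul_eq_mul]
  have h3 : ∫ x in Q, |f x - c| ≤ (∫ x in Q, |f x - g x|) + l ^ d * D := by
    calc ∫ x in Q, |f x - c| ≤ ∫ x in Q, (|f x - g x| + D) := by
          refine setIntegral_mono_on (hfQ.sub (hc c)).abs (((hfQ.sub hgQ).abs).add (hc _)) hQm
            fun x hx => ?_
          exact (abs_sub_le _ (g x) _).trans (add_le_add le_rfl (hD x hx))
      _ = _ := by
          rw [integral_add hi2 (hc _), setIntegral_const, hV, smul_eq_mul]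
  have h4 : (⨍ y in Q, |f y - A|) * l ^ d ≤ 2 * (∫ x in Q, |f x - g x|) + 2 * D * l ^ d := by
    rw [setAverage_eq, hV, smul_eq_mul, mul_comm, mul_inv_cancel_left₀ hVpos.ne']
    linarith
  have hD0 : 0 ≤ D := (abs_nonneg _).trans (hD _ (cubeSet_corner a l hl.le))
  have h5 : ENNReal.ofReal (∫ x in Q, |f x - g x|) = ∫⁻ x in Q, ‖f x - g x‖ₑ := by
    rw [← ofReal_integral_norm_eq_lintegral_enorm hi0]
    rfl
  rw [← ENNReal.ofReal_mul' hVpos.le, ← h5, ← ENNReal.ofReal_mul' hVpos.le]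
  refine (ENNReal.ofReal_le_ofReal h4).trans (le_of_eq ?_)
  have h6 : 0 ≤ ∫ x in Q, |f x - g x| := integral_nonneg fun x => abs_nonneg _
  rw [ENNReal.ofReal_add (by positivity) (by positivity), ENNReal.ofReal_mul (by norm_num : (0:ℝ) ≤ 2)]
  simp

def CB (d : ℕ) (K p : ℝ) (k : ℕ) : ℝ := 2 * 2 ^ (k * (k + 1)) + 4 * d * CA d K p k

theorem CB_nonneg {d : ℕ} {K p : ℝ} {k : ℕ} (hK : 0 ≤ K) : 0 ≤ CB d K p k := by
  have := CA_nonneg (d := d) (p := p) (k := k) hK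
  unfold CB; positivity

theorem osc_small (hφ : IsKer φ K) (k : ℕ) {p : ℝ} (hp : 1 < p) (hk : (k : ℝ) ≤ (d : ℝ) / p)
    {f : Euc d → ℝ} {Mf M0 L0 : ℝ} (hMf : 0 ≤ Mf) (hf : WB p f Mf) (hM0 : 0 ≤ M0) (hL0 : 0 < L0)
    (H0 : ∀ h : Euc d, ‖h‖ ≤ L0 → WB p (iterDiff k h f) M0) (m : ℕ) (a : Fin d → ℝ) (l : ℝ)
    (hl : 0 < l) (hlL : l ≤ 2 ^ ((k + 1) * m) * L0) :
    ENNReal.ofReal (⨍ y in cubeSet a l, |f y - ⨍ z in cubeSet a l, f z|) * ENNReal.ofReal (l ^ d) ≤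
      2 * (∫⁻ x in cubeSet a l, ‖f x - tOp k φ (2 ^ ((k + 1) * m) * L0) f x‖ₑ) +
        ENNReal.ofReal (4 * d * CA d K p k * ((L0 ^ d) ^ (-(1 / p)) * M0)) *
          ENNReal.ofReal (l ^ d) := by
  have hrec := recursion hφ k hp hk hMf hf hM0 hL0 H0 m
  have hCA : 0 ≤ CA d K p k := CA_nonneg hφ.Kpos
  set L := 2 ^ ((k + 1) * m) * L0 with hL
  have hLpos : 0 < L := by positivity
  set B := (L0 ^ d) ^ (-(1 / p)) * M0 with hB
  have hB0 : 0 ≤ B := by positivity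
  refine (osc_real hf.loc hrec.cont a l hl (2 * CA d K p k * B * d) ?_).trans (le_of_eq ?_)
  · intro x hx
    refine (hrec x _).trans ?_
    have h1 := cubeSet_dist a l hl.le x _ hx (cubeSet_corner a l hl.le)
    calc _ ≤ 2 * CA d K p k * B / L * (d * L) := by gcongr; exact h1.trans (by gcongr)
      _ = _ := by field_simp
  · congr 3; ring

theorem osc_large (hφ : IsKer φ K) (k : ℕ) {p : ℝ} (hp : 1 < p) (hk : (k : ℝ) ≤ (d : ℝ) / p)
    {f : Euc d → ℝ} {Mf M0 L0 : ℝ} (hMf : 0 ≤ Mf) (hf : WB p f Mf) (hM0 : 0 ≤ M0) (hL0 : 0 < L0)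
    (H0 : ∀ h : Euc d, ‖h‖ ≤ L0 → WB p (iterDiff k h f) M0) (a : Fin d → ℝ) (l : ℝ)
    (hlL : L0 < l) :
    ENNReal.ofReal (⨍ y in cubeSet a l, |f y - ⨍ z in cubeSet a l, f z|) ≤
        ENNReal.ofReal (CB d K p k * ((L0 ^ d) ^ (-(1 / p)) * M0)) := by
  have hl : 0 < l := hL0.trans hlL
  have hCA : 0 ≤ CA d K p k := CA_nonneg hφ.Kpos
  obtain ⟨m, hm1, hm2⟩ := exists_nat_pow_near (x := l / L0) (y := (2:ℝ) ^ (k + 1))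
    ((one_le_div hL0).2 hlL.le) (one_lt_pow₀ (by norm_num) (by omega))
  rw [← pow_mul, le_div_iff₀ hL0] at hm1
  rw [← pow_mul, div_lt_iff₀ hL0] at hm2
  have h1 := osc_small hφ k hp hk hMf hf hM0 hL0 H0 (m + 1) a l hl hm2.le
  have hw : WB p (fun x => f x - tOp k φ (2 ^ ((k + 1) * (m + 1)) * L0) f x)
      (2 ^ (k * ((k + 1) * (m + 1))) * M0) :=
    hφ.tOp_errWB k hp hMf hf (by positivity)
      (WB_doubling k f L0 M0 hM0 H0 ((k + 1) * (m + 1)))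
  have h2 := hw.2 (cubeSet a l) (cubeSet_closed a l).measurableSet (l ^ d) (by positivity)
    (cubeSet_vol a l hl.le).le
  set B := (L0 ^ d) ^ (-(1 / p)) * M0 with hB
  have hB0 : 0 ≤ B := by positivity
  have h3 : (l ^ d) ^ (1 - 1 / p) * (2 ^ (k * ((k + 1) * (m + 1))) * M0) ≤
      2 ^ (k * (k + 1)) * B * l ^ d := by
    have h4 : (l ^ d) ^ (1 - 1 / p) = l ^ d * (l ^ d) ^ (-(1 / p)) := by
      rw [sub_eq_add_neg, Real.rpow_add (by positivity), Real.rpow_one]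
    have h5 : (l ^ d) ^ (-(1 / p)) ≤ ((2 ^ ((k + 1) * m) * L0) ^ d) ^ (-(1 / p)) := by
      refine Real.rpow_le_rpow_of_nonpos (by positivity) (by gcongr) ?_
      have : 0 ≤ 1 / p := by positivity
      linarith
    have h6 := scale_ineq d p hp k hk L0 hL0 ((k + 1) * m)
    have h7 : (2:ℝ) ^ (k * ((k + 1) * (m + 1))) = 2 ^ (k * ((k + 1) * m)) * 2 ^ (k * (k + 1)) := by
      rw [← pow_add]; congr 1; ring
    have h8 : (l ^ d) ^ (-(1 / p)) * 2 ^ (k * ((k + 1) * m)) ≤ (L0 ^ d) ^ (-(1 / p)) :=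
      (mul_le_mul_of_nonneg_right h5 (by positivity)).trans h6
    have h9 : 0 ≤ 2 ^ (k * (k + 1)) * M0 * l ^ d := by positivity
    have h10 := mul_le_mul_of_nonneg_left h8 h9
    rw [h4, h7, hB]
    generalize (l ^ d) ^ (-(1 / p)) = X1 at h10 ⊢
    generalize (L0 ^ d) ^ (-(1 / p)) = X2 at h10 ⊢
    generalize (2:ℝ) ^ (k * ((k + 1) * m)) = X3 at h10 ⊢
    generalize (2:ℝ) ^ (k * (k + 1)) = X4 at h10 ⊢
    linarith
  have h4 := h2.trans (ENNReal.ofReal_le_ofReal h3)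
  rw [ENNReal.ofReal_mul (by positivity)] at h4
  have hv0 : ENNReal.ofReal (l ^ d) ≠ 0 := by
    rw [Ne, ENNReal.ofReal_eq_zero, not_le]; positivity
  rw [← ENNReal.mul_le_mul_iff_left hv0 ENNReal.ofReal_ne_top]
  refine h1.trans ?_
  calc _ ≤ 2 * (ENNReal.ofReal (2 ^ (k * (k + 1)) * B) * ENNReal.ofReal (l ^ d)) +
        ENNReal.ofReal (4 * d * CA d K p k * B) * ENNReal.ofReal (l ^ d) := by
        exact add_le_add (mul_le_mul' le_rfl h4) le_rfl
    _ = (ENNReal.ofReal 2 * ENNReal.ofReal (2 ^ (k * (k + 1)) * B) +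
        ENNReal.ofReal (4 * d * CA d K p k * B)) * ENNReal.ofReal (l ^ d) := by
        have h22 : ENNReal.ofReal 2 = 2 := by simp
        rw [add_mul, h22]
        congr 1
        exact (mul_assoc _ _ _).symm
    _ = _ := by
        rw [← ENNReal.ofReal_mul (by norm_num), ← ENNReal.ofReal_add (by positivity) (by positivity)]
        congr 2
        unfold CB; ring

end

section

theorem cube_enlarge {d : ℕ} (x y : Fin d → ℝ) (s r : ℝ) (h : (cubeSet x s ∩ cubeSet y r).Nonempty)
    (hsr : s ≤ 2 * r) : cubeSet x s ⊆ cubeSet (fun i => y i - 2 * r) (5 * r) := by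
  obtain ⟨z, hz1, hz2⟩ := h
  intro w hw i
  have h1 := hz1 i
  have h2 := hz2 i
  have h3 := hw i
  constructor <;> dsimp only <;> linarith

theorem rearr_sharp {d : ℕ} (f g : Euc d → ℝ) (A : ℝ≥0∞) (F : ℝ → ℝ≥0∞) (L0 : ℝ)
    (hF : ∀ s u, s ≤ u → F u ≤ F s)
    (hlarge : ∀ (a : Fin d → ℝ) (l : ℝ), L0 < l →
      ENNReal.ofReal (⨍ y in cubeSet a l, |f y - ⨍ z in cubeSet a l, f z|) ≤ A)
    (hsmall : ∀ (a : Fin d → ℝ) (l : ℝ), 0 < l → l ≤ L0 →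
      ENNReal.ofReal (⨍ y in cubeSet a l, |f y - ⨍ z in cubeSet a l, f z|) * ENNReal.ofReal (l ^ d) ≤
        2 * (∫⁻ x in cubeSet a l, ‖f x - g x‖ₑ) + A * ENNReal.ofReal (l ^ d))
    (hE : ∀ v : ℝ, 0 < v → ∀ E : Set (Euc d), MeasurableSet E → volume E ≤ ENNReal.ofReal v →
      ∫⁻ x in E, ‖f x - g x‖ₑ ≤ ENNReal.ofReal v * F v) (u : ℝ) (hu : 0 < u) :
    rearr volume (sharp f) u ≤ 2 * F (u / 5 ^ d) + A := by
  set lam := 2 * F (u / 5 ^ d) + A with hlam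
  refine sInf_le ?_
  rw [mem_setOf_eq]
  by_contra hcon
  rw [not_le] at hcon
  let Q : (Fin d → ℝ) × ℝ → Set (Euc d) := fun i => cubeSet i.1 i.2
  let S : Set ((Fin d → ℝ) × ℝ) := {i | 0 < i.2 ∧
    lam < ENNReal.ofReal (⨍ y in cubeSet i.1 i.2, |f y - ⨍ z in cubeSet i.1 i.2, f z|)}
  have hSL : ∀ i ∈ S, i.2 ≤ L0 := by
    intro i hi
    by_contra hn
    have h1 := hlarge i.1 i.2 (not_le.1 hn)
    exact absurd (hi.2.trans_le h1) (not_lt.2 le_add_self)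
  obtain ⟨U, hUS, hdisj, hcov⟩ := Vitali.exists_disjoint_subfamily_covering_enlargement Q S
    (fun i => i.2) 2 (by norm_num) (fun i hi => hi.1.le) L0 hSL
    (fun i hi => ⟨_, cubeSet_corner i.1 i.2 hi.1.le⟩)
  have hQm : ∀ i, MeasurableSet (Q i) := fun i => (cubeSet_closed i.1 i.2).measurableSet
  have hUc : U.Countable := by
    have h1 := Measure.countable_meas_pos_of_disjoint_iUnion (μ := (volume : Measure (Euc d)))
      (As := fun i : U => Q i) (fun i => hQm i)
      (fun i j hij => hdisj i.2 j.2 (fun h => hij (Subtype.ext h)))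
    have h2 : {i : U | 0 < volume (Q i)} = univ := by
      ext i
      simp only [mem_setOf_eq, mem_univ, iff_true]
      have := (hUS i.2).1
      rw [cubeSet_vol _ _ this.le, ENNReal.ofReal_pos]
      positivity
    rw [h2, countable_univ_iff] at h1
    exact h1.to_set
  have hsub : {x | lam < sharp f x} ⊆ ⋃ i ∈ U, cubeSet (fun j => i.1 j - 2 * i.2) (5 * i.2) := by
    intro x hx
    rw [mem_setOf_eq, sharp, lt_iSup_iff] at hx
    obtain ⟨q, hx⟩ := hx
    rw [lt_iSup_iff] at hx
    obtain ⟨⟨⟨a, l, hl, rfl⟩, hxq⟩, hx⟩ := hx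
    obtain ⟨b, hb, hne, hle⟩ := hcov (a, l) ⟨hl, hx⟩
    exact mem_biUnion hb (cube_enlarge a b.1 l b.2 hne hle hxq)
  have : Countable U := hUc.to_subtype
  have hsum : ENNReal.ofReal u < ∑' i : U, ENNReal.ofReal ((5 * i.1.2) ^ d) := by
    refine hcon.trans_le ((measure_mono hsub).trans ?_)
    rw [biUnion_eq_iUnion]
    refine (measure_iUnion_le _).trans (ENNReal.tsum_le_tsum fun i => ?_)
    have := (hUS i.2).1
    exact (cubeSet_vol _ _ (by positivity)).le
  rw [ENNReal.tsum_eq_iSup_sum, lt_iSup_iff] at hsum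
  obtain ⟨s, hs⟩ := hsum
  have hpos : ∀ i : U, 0 < i.1.2 := fun i => (hUS i.2).1
  set v := ∑ i ∈ s, (i.1.2) ^ d with hv
  have hv1 : ENNReal.ofReal v = ∑ i ∈ s, ENNReal.ofReal ((i.1.2) ^ d) :=
    ENNReal.ofReal_sum_of_nonneg fun i _ => (pow_pos (hpos i) d).le
  have huv : u / 5 ^ d < v := by
    rw [← ENNReal.ofReal_sum_of_nonneg (fun i _ => (pow_pos (by have := hpos i; positivity) d).le),
      ENNReal.ofReal_lt_ofReal_iff_of_nonneg hu.le] at hs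
    simp only [mul_pow, ← Finset.mul_sum] at hs
    rw [div_lt_iff₀ (by positivity), mul_comm]
    exact hs
  have hv0 : 0 < v := lt_trans (by positivity) huv
  have hsne : s.Nonempty := by
    rw [Finset.nonempty_iff_ne_empty]
    rintro rfl
    simp [hv] at hv0
  have hEv : volume (⋃ i ∈ s, Q i.1) ≤ ENNReal.ofReal v := by
    refine (measure_biUnion_finset_le _ _).trans ?_
    rw [hv1]
    exact Finset.sum_le_sum fun i _ => (cubeSet_vol _ _ (hpos i).le).le
  have hint : ∫⁻ x in ⋃ i ∈ s, Q i.1, ‖f x - g x‖ₑ = ∑ i ∈ s, ∫⁻ x in Q i.1, ‖f x - g x‖ₑ := by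
    refine lintegral_biUnion_finset (s := s) (t := fun i : U => Q i.1) (fun i _ j _ hij => ?_) (fun i _ => hQm i.1) _
    exact hdisj i.2 j.2 (fun h => hij (Subtype.ext h))
  have hfinal := hE v hv0 _ (s.measurableSet_biUnion fun i _ => hQm i.1) hEv
  have hlt : lam * ENNReal.ofReal v < lam * ENNReal.ofReal v := by
    calc lam * ENNReal.ofReal v = ∑ i ∈ s, lam * ENNReal.ofReal ((i.1.2) ^ d) := by
          rw [hv1, Finset.mul_sum]
      _ < ∑ i ∈ s, (2 * (∫⁻ x in Q i.1, ‖f x - g x‖ₑ) + A * ENNReal.ofReal ((i.1.2) ^ d)) := by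
          refine ENNReal.sum_lt_sum_of_nonempty hsne fun i _ => ?_
          refine lt_of_lt_of_le ?_ (hsmall i.1.1 i.1.2 (hpos i) (hSL _ (hUS i.2)))
          refine (ENNReal.mul_lt_mul_iff_left ?_ ENNReal.ofReal_ne_top).2 (hUS i.2).2
          rw [Ne, ENNReal.ofReal_eq_zero, not_le]
          exact pow_pos (hpos i) d
      _ = 2 * (∫⁻ x in ⋃ i ∈ s, Q i.1, ‖f x - g x‖ₑ) + A * ENNReal.ofReal v := by
          rw [Finset.sum_add_distrib, ← Finset.mul_sum, ← Finset.mul_sum, hint, hv1]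
      _ ≤ 2 * (ENNReal.ofReal v * F v) + A * ENNReal.ofReal v :=
          add_le_add (mul_le_mul' le_rfl hfinal) le_rfl
      _ ≤ 2 * (ENNReal.ofReal v * F (u / 5 ^ d)) + A * ENNReal.ofReal v :=
          add_le_add (mul_le_mul' le_rfl (mul_le_mul' le_rfl (hF _ _ huv.le))) le_rfl
      _ = lam * ENNReal.ofReal v := by rw [hlam]; ring
  exact lt_irrefl _ hlt

end

theorem qnorm_pow (p : ℝ) (hp : 1 < p) (q : ℝ≥0∞) (hq : 0 < q) :
    ∃ C : ℝ≥0∞, C ≠ ∞ ∧ ∀ T : ℝ, 0 < T →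
      qnorm q (Ioo 0 T) (fun u => ENNReal.ofReal (u ^ (1 / p))) ≤
        C * ENNReal.ofReal (T ^ (1 / p)) := by
  have hp0 : 0 < p := by linarith
  by_cases hqt : q = ∞
  · refine ⟨1, by simp, fun T hT => ?_⟩
    simp only [qnorm, hqt, if_true, one_mul]
    refine iSup₂_le fun u hu => ENNReal.ofReal_le_ofReal ?_
    exact Real.rpow_le_rpow hu.1.le hu.2.le (by positivity)
  · set s := q.toReal with hs
    have hs0 : 0 < s := ENNReal.toReal_pos hq.ne' hqt
    refine ⟨ENNReal.ofReal (p / s) ^ (1 / s),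
      ENNReal.rpow_ne_top_of_nonneg (by positivity) ENNReal.ofReal_ne_top, fun T hT => ?_⟩
    simp only [qnorm, hqt, if_false]
    have hr : -1 < s / p - 1 := by have : 0 < s / p := by positivity
                                   linarith
    have h1 : ∫⁻ u in Ioo 0 T, ENNReal.ofReal (u ^ (1 / p)) ^ s / ENNReal.ofReal u =
        ∫⁻ u in Ioo 0 T, ENNReal.ofReal (u ^ (s / p - 1)) := by
      refine setLIntegral_congr_fun measurableSet_Ioo fun u hu => ?_
      have hu0 : 0 < u := hu.1
      rw [ENNReal.ofReal_rpow_of_pos (by positivity), ← ENNReal.ofReal_div_of_pos hu0,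
        ← Real.rpow_mul hu0.le, Real.rpow_sub_one hu0.ne']
      congr 3; ring
    have h2 : ∫⁻ u in Ioo 0 T, ENNReal.ofReal (u ^ (s / p - 1)) =
        ENNReal.ofReal (p / s * T ^ (s / p)) := by
      rw [← ofReal_integral_eq_lintegral_ofReal
        ((intervalIntegral.integrableOn_Ioo_rpow_iff hT).2 hr)]
      · rw [← integral_Ioc_eq_integral_Ioo, ← intervalIntegral.integral_of_le hT.le,
          integral_rpow (Or.inl hr)]
        congr 1
        have : s / p - 1 + 1 = s / p := by ring
        rw [this, Real.zero_rpow (by positivity)]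
        field_simp
        ring
      · refine (ae_restrict_iff' measurableSet_Ioo).2 (Eventually.of_forall fun u hu => ?_)
        exact Real.rpow_nonneg hu.1.le _
    rw [← hs, h1, h2, ENNReal.ofReal_mul (by positivity), ENNReal.mul_rpow_of_nonneg _ _ (by positivity),
      ENNReal.ofReal_rpow_of_pos (x := T ^ (s / p)) (by positivity), ← Real.rpow_mul hT.le]
    have : s / p * (1 / s) = 1 / p := by field_simp
    rw [this]

/-- DeVore-type inequality for the sharp maximal function, case `k ≤ d/p`
(Theorem 1.1, (1.8)). -/
theorem statement1 (d : ℕ) (hd : 0 < d) (p : ℝ) (hp : 1 < p)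
    (q : ℝ≥0∞) (hq : 0 < q) (k : ℕ) (hk0 : 0 < k) (hk : (k : ℝ) ≤ (d : ℝ) / p) :
    ∃ C : ℝ, 0 < C ∧ ∀ f : Euc d → ℝ, Measurable f →
      lorentz volume f p q (Set.Ioi 0) ≠ ∞ →
      ∀ t : ℝ, 0 < t →
        qnorm q (Set.Ioo 0 (t ^ d))
            (fun u => ENNReal.ofReal (u ^ (1 / p)) * rearr volume (sharp f) u) ≤
          ENNReal.ofReal C * modulus k f p q t := by
  have hp0 : 0 < p := by linarith
  obtain ⟨φ, K, hφ⟩ := exists_ker d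
  obtain ⟨Ce, hCe, hEnv⟩ := envelope_exists d p hp q hq k
  obtain ⟨Cw, hCw, hWB⟩ := WB_of_lorentz d p hp q hq
  obtain ⟨Ca, hCa, hadd⟩ := qnorm_add q hq
  obtain ⟨Cp, hCp, hpow⟩ := qnorm_pow p hp q hq
  have hCB : 0 ≤ CB d K p k := CB_nonneg hφ.Kpos
  set Ct : ℝ≥0∞ := Ca * (2 * (ENNReal.ofReal ((5 ^ d : ℝ) ^ (1 / p)) * Ce) +
    ENNReal.ofReal (CB d K p k * ((2 ^ d : ℝ) ^ (1 / p) * Cw)) * Cp) with hCt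
  have hCtt : Ct ≠ ∞ := by
    rw [hCt]
    refine ENNReal.mul_ne_top hCa (ENNReal.add_ne_top.2 ⟨?_, ENNReal.mul_ne_top ofReal_ne_top hCp⟩)
    exact ENNReal.mul_ne_top (by simp) (ENNReal.mul_ne_top ofReal_ne_top hCe)
  refine ⟨Ct.toReal + 1, by positivity, fun f hfm hfl t ht => ?_⟩
  have hCC : Ct ≤ ENNReal.ofReal (Ct.toReal + 1) := by
    rw [← ENNReal.ofReal_toReal hCtt]
    exact ENNReal.ofReal_le_ofReal (by rw [ENNReal.toReal_ofReal ENNReal.toReal_nonneg]; linarith)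
  by_cases hmt : modulus k f p q t = ∞
  · rw [hmt, ENNReal.mul_top]
    · exact le_top
    · have : 0 < Ct.toReal + 1 := by positivity
      simpa using this
  refine le_trans ?_ (mul_le_mul' hCC le_rfl)
  set W := (modulus k f p q t).toReal with hW
  have hW0 : 0 ≤ W := ENNReal.toReal_nonneg
  have hWe : ENNReal.ofReal W = modulus k f p q t := ENNReal.ofReal_toReal hmt
  set L0 := t / 2 with hL
  have hL0 : 0 < L0 := by positivity
  have hf : WB p f (Cw * (lorentz volume f p q (Ioi 0)).toReal) :=
    hWB f hfm _ ENNReal.toReal_nonneg (ENNReal.ofReal_toReal hfl).ge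
  have hMf : 0 ≤ Cw * (lorentz volume f p q (Ioi 0)).toReal :=
    mul_nonneg hCw ENNReal.toReal_nonneg
  have hM0 : 0 ≤ Cw * W := mul_nonneg hCw hW0
  have H0 : ∀ h : Euc d, ‖h‖ ≤ L0 → WB p (iterDiff k h f) (Cw * W) := by
    intro h hh
    refine hWB _ ?_ W hW0 ?_
    · exact (iterDiff_meas k f hfm).comp (measurable_const.prodMk measurable_id)
    · rw [hWe]
      exact modulus_le k f p q t h (hh.trans (by linarith))
  obtain ⟨F, hF, hFe, hFn⟩ := hEnv f hfm t ht
  set B := (L0 ^ d) ^ (-(1 / p)) * (Cw * W) with hB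
  have hB0 : 0 ≤ B := by positivity
  set A := ENNReal.ofReal (CB d K p k * B) with hA
  have hrs : ∀ u, 0 < u → rearr volume (sharp f) u ≤ 2 * F (u / 5 ^ d) + A := by
    intro u hu
    refine rearr_sharp f (tOp k φ L0 f) A F L0 hF ?_ ?_ ?_ u hu
    · intro a l hl
      exact osc_large hφ k hp hk hMf hf hM0 hL0 H0 a l hl
    · intro a l hl hlL
      have := osc_small hφ k hp hk hMf hf hM0 hL0 H0 0 a l hl (by simpa using hlL)
      simp only [mul_zero, pow_zero, one_mul] at this
      refine this.trans (add_le_add le_rfl (mul_le_mul' (ENNReal.ofReal_le_ofReal ?_) le_rfl))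
      refine mul_le_mul_of_nonneg_right ?_ hB0
      have : (0:ℝ) ≤ 2 * 2 ^ (k * (k + 1)) := by positivity
      unfold CB
      linarith
    · intro v hv E hE hEv
      exact hφ.tOp_err k hfm hf.loc hL0 E _ fun c hc => hFe c hc v hv E hE hEv
  have hAT : A * ENNReal.ofReal ((t ^ d) ^ (1 / p)) =
      ENNReal.ofReal (CB d K p k * ((2 ^ d : ℝ) ^ (1 / p) * Cw)) * modulus k f p q t := by
    rw [← hWe, hA, ← ENNReal.ofReal_mul (by positivity), ← ENNReal.ofReal_mul (by positivity)]
    congr 1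
    have h1 : (t ^ d) ^ (1 / p) = (2 ^ d : ℝ) ^ (1 / p) * (L0 ^ d) ^ (1 / p) := by
      rw [← Real.mul_rpow (by positivity) (by positivity), ← mul_pow, hL]
      congr 2; ring
    have h2 : (L0 ^ d) ^ (-(1 / p)) * (L0 ^ d) ^ (1 / p) = 1 := by
      rw [← Real.rpow_add (by positivity)]; simp
    rw [h1, hB]
    linear_combination (CB d K p k * Cw * W * (2 ^ d : ℝ) ^ (1 / p)) * h2
  calc qnorm q (Ioo 0 (t ^ d)) (fun u => ENNReal.ofReal (u ^ (1 / p)) * rearr volume (sharp f) u)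
      ≤ qnorm q (Ioo 0 (t ^ d)) (fun u => 2 * (ENNReal.ofReal (u ^ (1 / p)) * F (u / 5 ^ d)) +
          A * ENNReal.ofReal (u ^ (1 / p))) := by
        refine qnorm_mono q Subset.rfl measurableSet_Ioo fun u hu => ?_
        refine (mul_le_mul' le_rfl (hrs u hu.1)).trans (le_of_eq ?_)
        ring
    _ ≤ Ca * (qnorm q (Ioo 0 (t ^ d)) (fun u => 2 * (ENNReal.ofReal (u ^ (1 / p)) * F (u / 5 ^ d))) +
          qnorm q (Ioo 0 (t ^ d)) (fun u => A * ENNReal.ofReal (u ^ (1 / p)))) := by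
        refine hadd _ measurableSet_Ioo _ _ ?_
        fun_prop
    _ ≤ Ca * (2 * (ENNReal.ofReal ((5 ^ d : ℝ) ^ (1 / p)) * (Ce * modulus k f p q t)) +
          A * (Cp * ENNReal.ofReal ((t ^ d) ^ (1 / p)))) := by
        refine mul_le_mul' le_rfl (add_le_add ?_ ?_)
        · rw [qnorm_const_mul q hq _ _ 2 (by simp)]
          refine mul_le_mul' le_rfl ?_
          refine (qnorm_mono q Ioo_subset_Ioi_self measurableSet_Ioo fun u _ => le_rfl).trans ?_
          refine (qnorm_dil q hq p F (5 ^ d) (by positivity)).trans ?_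
          exact mul_le_mul' le_rfl hFn
        · rw [qnorm_const_mul q hq _ _ A ofReal_ne_top]
          exact mul_le_mul' le_rfl (hpow _ (by positivity))
    _ = Ct * modulus k f p q t := by
        rw [mul_left_comm A Cp, hAT, hCt]
        ring

end
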